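/- arXiv:1801.03810 — 2 statements merged into one kernel-verified Lean document; each statement's English description precedes it below -/
import Mathlib

section
/- (Sharp interpolation on the circle, subcritical case) For every p > 2, every β with 0 < β ≤ 1/(p-2), and every real-valued u ∈ H¹(S¹), one has ‖u'‖²_{L²} + β‖u‖²_{L²} ≥ β‖u‖²_{L^p}, where all norms are with respect to the uniform probability measure on (-π,π]. Moreover, equality holds only for constant functions. -/
open Real MeasureTheory


lemma hyp_sinh (p : ℝ) (hp : 2 < p) (x : ℝ) (hx : 0 < x) :
    p * sinh ((p-2)*x) < (p-2) * sinh (p*x) := by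
  have hd : ∀ y : ℝ, HasDerivAt (fun y => (p-2) * sinh (p*y) - p * sinh ((p-2)*y))
      ((p-2) * (cosh (p*y) * p) - p * (cosh ((p-2)*y) * (p-2))) y := by
    intro y
    have h1 : HasDerivAt (fun y : ℝ => p*y) p y := by simpa using (hasDerivAt_id y).const_mul p
    have h2 : HasDerivAt (fun y : ℝ => (p-2)*y) (p-2) y := by
      simpa using (hasDerivAt_id y).const_mul (p-2)
    exact (h1.sinh.const_mul _).sub (h2.sinh.const_mul _)
  have hm : StrictMonoOn (fun y => (p-2) * sinh (p*y) - p * sinh ((p-2)*y)) (Set.Ici 0) := by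
    apply strictMonoOn_of_deriv_pos (convex_Ici 0)
    · exact fun y _ => (hd y).continuousAt.continuousWithinAt
    · intro y hy
      rw [interior_Ici] at hy
      have hy : 0 < y := hy
      rw [(hd y).deriv]
      have : cosh ((p-2)*y) < cosh (p*y) := by
        rw [cosh_lt_cosh, abs_of_pos (by nlinarith), abs_of_pos (by nlinarith)]
        nlinarith
      have : 0 < (p-2)*p := by nlinarith
      nlinarith
  have := hm (Set.mem_Ici.2 le_rfl) (Set.mem_Ici.2 hx.le) hx
  simp at this
  linarith

lemma hyp_coth (p : ℝ) (hp : 2 < p) (x : ℝ) (hx : 0 < x) :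
    0 < p * (sinh (2*x) * cosh (p*x)) - 2 * (cosh (2*x) * sinh (p*x)) := by
  have hd : ∀ y : ℝ, HasDerivAt (fun y => p * (sinh (2*y) * cosh (p*y)) - 2 * (cosh (2*y) * sinh (p*y)))
      (p * (cosh (2*y) * 2 * cosh (p*y) + sinh (2*y) * (sinh (p*y) * p))
        - 2 * (sinh (2*y) * 2 * sinh (p*y) + cosh (2*y) * (cosh (p*y) * p))) y := by
    intro y
    have h1 : HasDerivAt (fun y : ℝ => p*y) p y := by simpa using (hasDerivAt_id y).const_mul p
    have h2 : HasDerivAt (fun y : ℝ => 2*y) 2 y := by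
      simpa using (hasDerivAt_id y).const_mul 2
    exact ((h2.sinh.mul h1.cosh).const_mul _).sub ((h2.cosh.mul h1.sinh).const_mul _)
  have hm : StrictMonoOn (fun y => p * (sinh (2*y) * cosh (p*y)) - 2 * (cosh (2*y) * sinh (p*y))) (Set.Ici 0) := by
    apply strictMonoOn_of_deriv_pos (convex_Ici 0)
    · exact fun y _ => (hd y).continuousAt.continuousWithinAt
    · intro y hy
      rw [interior_Ici] at hy
      have hy : 0 < y := hy
      rw [(hd y).deriv]
      have h1 : 0 < sinh (2*y) := sinh_pos_iff.2 (by linarith)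
      have h2 : 0 < sinh (p*y) := sinh_pos_iff.2 (by nlinarith)
      have h3 : 0 < p^2-4 := by nlinarith
      have := mul_pos h3 (mul_pos h1 h2)
      nlinarith
  have := hm (Set.mem_Ici.2 le_rfl) (Set.mem_Ici.2 hx.le) hx
  simpa using this

lemma sinh_sub_eq (p x : ℝ) : sinh ((p-2)*x) = sinh (p*x) * cosh (2*x) - cosh (p*x) * sinh (2*x) := by
  rw [sub_mul, sinh_sub]

noncomputable def Lfun (p x : ℝ) : ℝ :=
  (2/(p-2)) * log (sinh (2*x) / sinh (p*x))
    + log ((p-2)*(cosh (2*x) - 1) + 2 * (cosh (2*x) - sinh (2*x) * cosh (p*x) / sinh (p*x)))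

lemma Lfun_arg_pos (p : ℝ) (hp : 2 < p) (x : ℝ) (hx : 0 < x) :
    0 < (p-2)*(cosh (2*x) - 1) + 2 * (cosh (2*x) - sinh (2*x) * cosh (p*x) / sinh (p*x)) := by
  have h2 : 0 < sinh (p*x) := sinh_pos_iff.2 (by nlinarith)
  have h3 : 0 < sinh ((p-2)*x) := sinh_pos_iff.2 (by nlinarith)
  have h4 := one_le_cosh (2*x)
  have : cosh (2*x) - sinh (2*x) * cosh (p*x) / sinh (p*x) = sinh ((p-2)*x) / sinh (p*x) := by
    rw [sinh_sub_eq]; field_simp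
  rw [this]
  have : 0 ≤ (p-2)*(cosh (2*x) - 1) := mul_nonneg (by linarith) (by linarith)
  positivity

lemma Lfun_strictMono (p : ℝ) (hp : 2 < p) : StrictMonoOn (Lfun p) (Set.Ioi 0) := by
  have hd : ∀ y : ℝ, 0 < y → ∃ d, 0 < d ∧ HasDerivAt (Lfun p) d y := by
    intro y hy
    have h1 : HasDerivAt (fun y : ℝ => p*y) p y := by simpa using (hasDerivAt_id y).const_mul p
    have h2 : HasDerivAt (fun y : ℝ => 2*y) 2 y := by
      simpa using (hasDerivAt_id y).const_mul 2
    have ha : 0 < sinh (2*y) := sinh_pos_iff.2 (by linarith)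
    have hS : 0 < sinh (p*y) := sinh_pos_iff.2 (by nlinarith)
    have hG := Lfun_arg_pos p hp y hy
    have hh1 := hyp_sinh p hp y hy
    have hh2 := hyp_coth p hp y hy
    rw [sinh_sub_eq] at hh1
    have hb := cosh_sq (2*y)
    have hK := cosh_sq (p*y)
    have hKp := cosh_pos (p*y)
    have hD := (((h2.sinh.div h1.sinh hS.ne').log (div_pos ha hS).ne').const_mul (2/(p-2))).add
      ((((h2.cosh.sub_const 1).const_mul (p-2)).add ((h2.cosh.sub
        ((h2.sinh.mul h1.cosh).div h1.sinh hS.ne')).const_mul 2)).log hG.ne')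
    refine ⟨_, ?_, hD⟩
    simp only [Pi.mul_apply, Pi.div_apply, Pi.add_apply, Pi.sub_apply]
    generalize sinh (2*y) = a at *
    generalize cosh (2*y) = b at *
    generalize sinh (p*y) = S at *
    generalize cosh (p*y) = K at *
    set G := (p - 2) * (b - 1) + 2 * (b - a * K / S) with hGdef
    have hq : 0 < p - 2 := by linarith
    have hGS : G * S = (p-2)*(b-1)*S + 2*(b*S - a*K) := by
      rw [hGdef]; field_simp
    have e1 : 2 / (p - 2) * ((b * 2 * S - a * (K * p)) / S ^ 2 / (a / S))
        = - (2 * (p*(a*K) - 2*(b*S)) / ((p-2)*a*S)) := by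
      field_simp; ring
    have e2 : (p - 2) * (a * 2) + 2 * (a * 2 - ((b * 2 * K + a * (S * p)) * S - a * K * (K * p)) / S ^ 2)
        = 2 * K * (p*(a*K) - 2*(b*S)) / S^2 := by
      field_simp; ring
    rw [e1, e2]
    have e3 : - (2 * (p*(a*K) - 2*(b*S)) / ((p-2)*a*S)) + 2 * K * (p*(a*K) - 2*(b*S)) / S^2 / G
      = 2 * (p*(a*K) - 2*(b*S)) * ((p-2)*a*K - G*S) / ((p-2)*a*S*(G*S)) := by
      field_simp; ring
    rw [e3]
    apply div_pos
    · apply mul_pos (by linarith)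
      rw [hGS]; nlinarith
    · positivity
  apply strictMonoOn_of_deriv_pos (convex_Ioi 0)
  · intro y hy
    obtain ⟨d, _, h⟩ := hd y hy
    exact h.continuousAt.continuousWithinAt
  · intro y hy
    rw [interior_Ioi] at hy
    obtain ⟨d, h0, h⟩ := hd y hy
    rwa [h.deriv]

lemma sinh_div_tendsto (a : ℝ) :
    Filter.Tendsto (fun x : ℝ => sinh (a*x) / x) (nhdsWithin 0 (Set.Ioi 0)) (nhds a) := by
  have h1 : HasDerivAt (fun y : ℝ => a*y) a 0 := by simpa using (hasDerivAt_id (0:ℝ)).const_mul a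
  have h2 := h1.sinh
  have h3 := h2.tendsto_slope
  simp only [mul_zero, cosh_zero, one_mul] at h3
  have h4 := h3.mono_left (nhdsWithin_mono (0:ℝ) (fun x (hx : 0 < x) => hx.ne') : nhdsWithin 0 (Set.Ioi 0) ≤ nhdsWithin (0:ℝ) {0}ᶜ)
  refine h4.congr ?_
  intro x
  simp [slope_def_field]

lemma sinh_ratio_tendsto (a b : ℝ) (hb : b ≠ 0) :
    Filter.Tendsto (fun x : ℝ => sinh (a*x) / sinh (b*x)) (nhdsWithin 0 (Set.Ioi 0)) (nhds (a/b)) := by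
  refine ((sinh_div_tendsto a).div (sinh_div_tendsto b) hb).congr' ?_
  filter_upwards [self_mem_nhdsWithin] with x hx
  have : x ≠ 0 := ne_of_gt hx
  simp only [Pi.div_apply]
  rw [div_div_div_cancel_right₀ this]

lemma Lfun_gt (p : ℝ) (hp : 2 < p) (x : ℝ) (hx : 0 < x) :
    (2/(p-2)) * log (2/p) + log (2 * ((p-2)/p)) < Lfun p x := by
  have hlim : Filter.Tendsto (Lfun p) (nhdsWithin 0 (Set.Ioi 0))
      (nhds ((2/(p-2)) * log (2/p) + log (2 * ((p-2)/p)))) := by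
    unfold Lfun
    apply Filter.Tendsto.add
    · apply Filter.Tendsto.const_mul
      apply Filter.Tendsto.log (sinh_ratio_tendsto 2 p (by linarith))
      have : 0 < 2/p := by apply div_pos <;> linarith
      exact this.ne'
    · apply Filter.Tendsto.log
      · have h1 : Filter.Tendsto (fun x : ℝ => (p-2)*(cosh (2*x) - 1)) (nhdsWithin 0 (Set.Ioi 0)) (nhds 0) := by
          have : Continuous (fun x : ℝ => (p-2)*(cosh (2*x) - 1)) := by fun_prop
          have h := (this.tendsto 0).mono_left (nhdsWithin_le_nhds (s := Set.Ioi 0))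
          simpa using h
        have h2 := h1.add ((sinh_ratio_tendsto (p-2) p (by linarith)).const_mul 2)
        rw [zero_add] at h2
        refine h2.congr' ?_
        filter_upwards [self_mem_nhdsWithin] with x hx
        have hS : 0 < sinh (p*x) := sinh_pos_iff.2 (mul_pos (by linarith) hx)
        rw [sinh_sub_eq]; field_simp
      · have : 0 < (p-2)/p := by apply div_pos <;> linarith
        positivity
  have hm := Lfun_strictMono p hp
  have h1 : Lfun p (x/2) < Lfun p x := hm (Set.mem_Ioi.2 (by linarith)) hx (by linarith)
  refine lt_of_le_of_lt ?_ h1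
  refine le_of_tendsto hlim ?_
  filter_upwards [Ioo_mem_nhdsGT (show (0:ℝ) < x/2 by linarith)] with y hy
  exact (hm hy.1 (Set.mem_Ioi.2 (by linarith)) hy.2).le

lemma width_key (p : ℝ) (hp : 2 < p) (v w : ℝ) (hv : 0 < v) (hvw : v < w)
    (h : w^2 - 2/p * w^p = v^2 - 2/p * v^p) :
    4/(p-2) * ((1 - 2/p) - (w^2 - 2/p * w^p)) < (w - v)^2 := by
  have hw : 0 < w := hv.trans hvw
  have hp0 : 0 < p := by linarith
  have hq : 0 < p - 2 := by linarith
  obtain ⟨α, x, hx, rfl, rfl⟩ : ∃ α x : ℝ, 0 < x ∧ v = exp (α - x) ∧ w = exp (α + x) := by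
    refine ⟨(log v + log w)/2, (log w - log v)/2, ?_, ?_, ?_⟩
    · have := log_lt_log hv hvw
      linarith
    · rw [show (log v + log w)/2 - (log w - log v)/2 = log v by ring, exp_log hv]
    · rw [show (log v + log w)/2 + (log w - log v)/2 = log w by ring, exp_log hw]
  have hL := Lfun_gt p hp x hx
  have hG := Lfun_arg_pos p hp x hx
  have ha : 0 < sinh (2*x) := sinh_pos_iff.2 (by linarith)
  have hS : 0 < sinh (p*x) := sinh_pos_iff.2 (by nlinarith)
  have ew2 : exp (α+x)^2 = exp (2*α) * (cosh (2*x) + sinh (2*x)) := by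
    rw [cosh_add_sinh, ← exp_add, sq, ← exp_add]; ring_nf
  have ev2 : exp (α-x)^2 = exp (2*α) * (cosh (2*x) - sinh (2*x)) := by
    rw [cosh_sub_sinh, ← exp_add, sq, ← exp_add]; ring_nf
  have ewp : exp (α+x)^p = exp (2*α) * exp ((p-2)*α) * (cosh (p*x) + sinh (p*x)) := by
    rw [cosh_add_sinh, ← exp_add, ← exp_add, ← exp_mul]; ring_nf
  have evp : exp (α-x)^p = exp (2*α) * exp ((p-2)*α) * (cosh (p*x) - sinh (p*x)) := by
    rw [cosh_sub_sinh, ← exp_add, ← exp_add, ← exp_mul]; ring_nf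
  have evw : exp (α+x) * exp (α-x) = exp (2*α) := by
    rw [← exp_add]; ring_nf
  have hsq : (exp (α+x) - exp (α-x))^2 = exp (2*α) * (2 * cosh (2*x) - 2) := by
    have : (exp (α+x) - exp (α-x))^2 = exp (α+x)^2 + exp (α-x)^2 - 2 * (exp (α+x) * exp (α-x)) := by ring
    rw [this, ew2, ev2, evw]; ring
  rw [hsq, ew2, ewp]
  rw [ew2, ev2, ewp, evp] at h
  have hE := exp_pos (2*α)
  have hEq : exp ((p-2)*α) = p / 2 * (sinh (2*x) / sinh (p*x)) := by
    have h5 : exp (2*α) * (2 * sinh (2*x)) = exp (2*α) * (4 / p * exp ((p-2)*α) * sinh (p*x)) := by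
      linear_combination h
    have h6 := mul_left_cancel₀ hE.ne' h5
    field_simp
    field_simp at h6
    rw [mul_comm x p] at h6
    linarith
  have hα : log (sinh (2*x) / sinh (p*x)) = (p-2)*α + log (2/p) := by
    have h7 : sinh (2*x) / sinh (p*x) = exp ((p-2)*α) * (2/p) := by
      rw [hEq]; field_simp
    rw [h7, log_mul (exp_pos _).ne' (by positivity), log_exp]
  unfold Lfun at hL
  rw [hα] at hL
  have h8 : log (2 * ((p-2)/p)) < log (exp (2*α) * ((p-2)*(cosh (2*x) - 1) + 2 * (cosh (2*x) - sinh (2*x) * cosh (p*x) / sinh (p*x)))) := by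
    rw [log_mul hE.ne' hG.ne', log_exp]
    have : 2 / (p - 2) * ((p - 2) * α + log (2 / p)) = 2*α + 2 / (p - 2) * log (2/p) := by
      field_simp
    linarith
  rw [log_lt_log_iff (by positivity) (by positivity)] at h8
  rw [hEq]
  have h9 : 4 / (p-2) * ((1 - 2/p) - (exp (2*α) * (cosh (2*x) + sinh (2*x)) - 2/p * (exp (2*α) * (p / 2 * (sinh (2*x) / sinh (p*x))) * (cosh (p*x) + sinh (p*x)))))
     = 2/(p-2) * (2 * ((p-2)/p) - exp (2*α) * ((p-2)*(cosh (2*x) - 1) + 2 * (cosh (2*x) - sinh (2*x) * cosh (p*x) / sinh (p*x)))) + exp (2*α) * (2 * cosh (2*x) - 2) := by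
    field_simp; ring
  rw [h9]
  have : 2/(p-2) * (2 * ((p-2)/p) - exp (2*α) * ((p-2)*(cosh (2*x) - 1) + 2 * (cosh (2*x) - sinh (2*x) * cosh (p*x) / sinh (p*x)))) < 0 :=
    mul_neg_of_pos_of_neg (by positivity) (by linarith)
  linarith

noncomputable def Wf (p t : ℝ) : ℝ := (t^2 - 2/p * t^p)/(p-2)

lemma Wf_cont (p : ℝ) (hp : 2 < p) : Continuous (Wf p) := by
  unfold Wf
  have : Continuous (fun t : ℝ => t^p) := Real.continuous_rpow_const (by linarith)
  fun_prop

lemma Wf_hasDeriv (p : ℝ) (hp : 2 < p) (t : ℝ) :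
    HasDerivAt (Wf p) ((2*t - 2 * t^(p-1))/(p-2)) t := by
  unfold Wf
  have h1 : HasDerivAt (fun t : ℝ => t^p) (p * t^(p-1)) t :=
    Real.hasDerivAt_rpow_const (Or.inr (by linarith))
  have h2 : HasDerivAt (fun t : ℝ => t^2) (2*t) t := by simpa using hasDerivAt_pow 2 t
  have h3 := (h2.sub (h1.const_mul (2/p))).div_const (p-2)
  have hp0 : p ≠ 0 := by linarith
  have e : 2 * t - 2/p * (p * t^(p-1)) = 2*t - 2 * t^(p-1) := by field_simp
  rw [e] at h3
  exact h3

lemma Wf_mono (p : ℝ) (hp : 2 < p) : StrictMonoOn (Wf p) (Set.Icc 0 1) := by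
  apply strictMonoOn_of_deriv_pos (convex_Icc 0 1) (Wf_cont p hp).continuousOn
  intro t ht
  rw [interior_Icc] at ht
  rw [(Wf_hasDeriv p hp t).deriv]
  apply div_pos _ (by linarith)
  have : t^(p-1) < t^(1:ℝ) := Real.rpow_lt_rpow_of_exponent_gt ht.1 ht.2 (by linarith)
  rw [rpow_one] at this
  linarith

lemma Wf_anti (p : ℝ) (hp : 2 < p) : StrictAntiOn (Wf p) (Set.Ici 1) := by
  apply strictAntiOn_of_deriv_neg (convex_Ici 1) (Wf_cont p hp).continuousOn
  intro t ht
  rw [interior_Ici] at ht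
  rw [(Wf_hasDeriv p hp t).deriv]
  apply div_neg_of_neg_of_pos _ (by linarith)
  have : t^(1:ℝ) < t^(p-1) := Real.rpow_lt_rpow_of_exponent_lt ht (by linarith)
  rw [rpow_one] at this
  linarith

lemma Wf_one (p : ℝ) : Wf p 1 = (1 - 2/p)/(p-2) := by simp [Wf]

lemma Wf_le_one (p : ℝ) (hp : 2 < p) (t : ℝ) (ht : 0 ≤ t) : Wf p t ≤ Wf p 1 := by
  rcases le_total t 1 with h | h
  · exact (Wf_mono p hp).monotoneOn ⟨ht, h⟩ ⟨by norm_num, le_rfl⟩ h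
  · exact (Wf_anti p hp).antitoneOn (Set.mem_Ici.2 le_rfl) h h

lemma Wf_ge (p : ℝ) (hp : 2 < p) (m M t E : ℝ) (hm : 0 ≤ m) (hmE : Wf p m = E)
    (hME : Wf p M = E) (h1 : m ≤ t) (h2 : t ≤ M) : E ≤ Wf p t := by
  rcases le_total t 1 with h | h
  · rw [← hmE]
    exact (Wf_mono p hp).monotoneOn ⟨hm, h1.trans h⟩ ⟨hm.trans h1, h⟩ h1
  · rw [← hME]
    exact (Wf_anti p hp).antitoneOn h (Set.mem_Ici.2 (h.trans h2)) h2

lemma half_disc (r : ℝ) (hr : 0 ≤ r) : ∫ z in (0:ℝ)..r, 2 * √(r^2 - z^2) = π/2 * r^2 := by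
  have hc : Continuous (fun z : ℝ => √(r^2 - z^2)) := by fun_prop
  have h1 : ∫ z in (-r)..r, √(r^2 - z^2) = π/2 * r^2 := by
    have := intervalIntegral.mul_integral_comp_mul_left (f := fun z => √(r^2 - z^2)) (a := -1) (b := 1) r
    simp only [mul_neg, mul_one] at this
    rw [← this]
    have e : ∀ x : ℝ, √(r^2 - (r*x)^2) = |r| * √(1 - x^2) := by
      intro x
      rw [show r^2 - (r*x)^2 = r^2 * (1-x^2) by ring, sqrt_mul (sq_nonneg r), sqrt_sq_eq_abs]
    simp only [e]
    rw [intervalIntegral.integral_const_mul, integral_sqrt_one_sub_sq]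
    rw [abs_of_nonneg hr]; ring
  have h2 : ∫ z in (-r)..0, √(r^2 - z^2) = ∫ z in (0:ℝ)..r, √(r^2 - z^2) := by
    have := intervalIntegral.integral_comp_neg (a := 0) (b := r) (fun z => √(r^2 - z^2))
    simp only [neg_sq, neg_zero] at this
    exact this.symm
  have h3 := intervalIntegral.integral_add_adjacent_intervals
    (hc.intervalIntegrable (μ := volume) (-r) 0) (hc.intervalIntegrable 0 r)
  rw [intervalIntegral.integral_const_mul]
  linarith

lemma area_key (p : ℝ) (hp : 2 < p) (m M E : ℝ) (hm : 0 ≤ m) (hm1 : m < 1) (hM1 : 1 < M)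
    (hmE : Wf p m = E) (hME : Wf p M = E) :
    π/2 * (Wf p 1 - E) < ∫ t in m..M, √(Wf p t - E) := by
  have hE1 : E < Wf p 1 := by
    rw [← hmE]; exact (Wf_mono p hp) ⟨hm, hm1.le⟩ ⟨by norm_num, le_rfl⟩ hm1
  set r := √(Wf p 1 - E) with hr
  have hr0 : 0 < r := sqrt_pos.2 (by linarith)
  have hr2 : r^2 = Wf p 1 - E := sq_sqrt (by linarith)
  have hWc := Wf_cont p hp
  have hfc : Continuous (fun t => √(Wf p t - E)) := by fun_prop
  have hq : 0 < p - 2 := by linarith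
  have hp0 : 0 < p := by linarith
  rw [intervalIntegral.integral_of_le (by linarith)]
  have hint : Integrable (fun t => √(Wf p t - E)) (volume.restrict (Set.Ioc m M)) :=
    (hfc.integrableOn_Icc).mono_set Set.Ioc_subset_Icc_self
  have hbd : (fun t => √(Wf p t - E)) ≤ᵐ[volume.restrict (Set.Ioc m M)] (fun _ => r) := by
    filter_upwards [ae_restrict_mem measurableSet_Ioc] with t ht
    exact sqrt_le_sqrt (by linarith [Wf_le_one p hp t (by linarith [ht.1])])
  rw [hint.integral_eq_integral_Ioc_meas_le (Filter.Eventually.of_forall fun t => sqrt_nonneg _) hbd,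
    ← intervalIntegral.integral_of_le hr0.le, ← hr2, ← half_disc r hr0.le, ← sub_pos]
  set φ : ℝ → ℝ := fun z => (volume.restrict (Set.Ioc m M)).real {a | z ≤ √(Wf p a - E)} with hφ
  have hanti : Antitone φ := by
    intro a b hab
    apply measureReal_mono
    · intro t ht
      exact hab.trans ht
    · exact measure_ne_top _ _
  have hφi : IntervalIntegrable φ volume 0 r := hanti.intervalIntegrable
  have hci : IntervalIntegrable (fun z : ℝ => 2 * √(r^2 - z^2)) volume 0 r :=
    Continuous.intervalIntegrable (by fun_prop) _ _
  rw [← intervalIntegral.integral_sub hφi hci]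
  apply intervalIntegral.intervalIntegral_pos_of_pos_on (hφi.sub hci) _ hr0
  intro z hz
  have hz2 : z^2 < r^2 := pow_lt_pow_left₀ hz.2 hz.1.le (by norm_num)
  have hz20 : 0 < z^2 := pow_pos hz.1 2
  obtain ⟨v, hv, hvE⟩ : ∃ v ∈ Set.Icc m 1, Wf p v = E + z^2 :=
    intermediate_value_Icc hm1.le hWc.continuousOn ⟨by linarith, by linarith⟩
  obtain ⟨w, hw, hwE⟩ : ∃ w ∈ Set.Icc 1 M, Wf p w = E + z^2 :=
    intermediate_value_Icc' hM1.le hWc.continuousOn ⟨by linarith, by linarith⟩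
  have hvm : m < v := lt_of_le_of_ne hv.1 (by rintro rfl; linarith)
  have hv1 : v < 1 := lt_of_le_of_ne hv.2 (by rintro rfl; linarith)
  have hk := width_key p hp v w (by linarith) (by linarith [hw.1]) (by
    have : Wf p w = Wf p v := by rw [hvE, hwE]
    unfold Wf at this
    field_simp at this ⊢
    linarith)
  have hk2 : 4/(p-2) * ((1 - 2/p) - (w^2 - 2/p * w^p)) = 4 * (r^2 - z^2) := by
    have : r^2 - z^2 = Wf p 1 - Wf p w := by rw [hwE, hr2]; ring
    rw [this, Wf_one, Wf]
    field_simp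
  rw [hk2] at hk
  have hk3 : 2 * √(r^2 - z^2) < w - v := by
    have : (2 * √(r^2 - z^2))^2 < (w - v)^2 := by
      rw [mul_pow, sq_sqrt (by linarith)]; linarith
    exact lt_of_pow_lt_pow_left₀ 2 (by linarith [hw.1]) this
  have hk4 : w - v ≤ φ z := by
    have : (volume.restrict (Set.Ioc m M)).real (Set.Ioc v w) = w - v := by
      rw [measureReal_restrict_apply measurableSet_Ioc,
        Set.inter_eq_left.2 (Set.Ioc_subset_Ioc hv.1 hw.2), Real.volume_real_Ioc_of_le (by linarith [hw.1])]
    rw [← this]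
    apply measureReal_mono _ (measure_ne_top _ _)
    intro t ht
    apply le_sqrt_of_sq_le
    have := Wf_ge p hp v w t (E+z^2) (by linarith) hvE hwE ht.1.le ht.2
    linarith
  linarith

lemma deriv_periodic (u : ℝ → ℝ) (T : ℝ) (h : Function.Periodic u T) : Function.Periodic (deriv u) T := by
  intro x
  rw [← deriv_comp_add_const, h.funext]

lemma core (p : ℝ) (hp : 2 < p) (u : ℝ → ℝ) (hu : Continuous u) (hper : Function.Periodic u (2 * π))
    (hdiff : Differentiable ℝ u)
    (hL2 : IntervalIntegrable (fun s => (deriv u s) ^ 2) volume (-π) π)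
    (m M E : ℝ) (hm : 0 ≤ m) (hm1 : m < 1) (hM1 : 1 < M)
    (hmE : Wf p m = E) (hME : Wf p M = E) (hmin : ∀ s, m ≤ |u s|) (hmax : ∀ s, |u s| ≤ M)
    (x0 x1 : ℝ) (hx0 : u x0 = m) (hx1 : u x1 = M) :
    2 * π * Wf p 1 < (∫ s in (-π)..π, (deriv u s)^2) + ∫ s in (-π)..π, Wf p |u s| := by
  have hpi := Real.pi_pos
  obtain ⟨x1, ⟨h01, h12⟩, hx1⟩ : ∃ y ∈ Set.Ico x0 (x0 + 2*π), u y = M := by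
    obtain ⟨y, hy, h⟩ := hper.exists_mem_Ico (by positivity) x1 x0
    exact ⟨y, hy, by rw [← h, hx1]⟩
  have hWc := Wf_cont p hp
  have hd2p : Function.Periodic (fun s => (deriv u s)^2) (2*π) := by
    intro x; simp only; rw [deriv_periodic u _ hper x]
  have hd2i : ∀ a b, IntervalIntegrable (fun s => (deriv u s)^2) volume a b := by
    intro a b
    apply hd2p.intervalIntegrable (t := -π) (by positivity)
    rwa [show -π + 2*π = π by ring]
  have hdi : ∀ a b, IntervalIntegrable (deriv u) volume a b := by
    intro a b
    refine ((hd2i a b).add (intervalIntegrable_const (c := (1:ℝ)))).mono_fun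
      (measurable_deriv u).aestronglyMeasurable (Filter.Eventually.of_forall fun x => ?_)
    simp only [Pi.add_apply, norm_eq_abs]
    rw [abs_of_nonneg (a := deriv u x ^2 + 1) (by positivity), ← sq_abs]
    nlinarith [sq_nonneg (|deriv u x| - 1), abs_nonneg (deriv u x)]
  set f : ℝ → ℝ := fun t => √(Wf p |t| - E) with hf
  have hfc : Continuous f := by fun_prop
  have hWu : Continuous (fun s => Wf p |u s|) := by fun_prop
  have hfui : ∀ a b, IntervalIntegrable (fun s => f (u s) * deriv u s) volume a b := fun a b =>
    (hdi a b).continuousOn_mul (hfc.comp hu).continuousOn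
  have hFTC : ∀ a b, ∫ s in a..b, f (u s) * deriv u s = ∫ t in (u a)..(u b), f t := by
    intro a b
    have hD : ∀ y, HasDerivAt (fun y => ∫ t in (0:ℝ)..y, f t) (f y) y := fun y =>
      intervalIntegral.integral_hasDerivAt_right (hfc.intervalIntegrable _ _)
        (hfc.stronglyMeasurableAtFilter _ _) hfc.continuousAt
    rw [intervalIntegral.integral_eq_sub_of_hasDerivAt (f := fun s => ∫ t in (0:ℝ)..(u s), f t)
      (fun s _ => (hD (u s)).comp s (hdiff s).hasDerivAt) (hfui a b)]
    exact intervalIntegral.integral_interval_sub_left (hfc.intervalIntegrable _ _) (hfc.intervalIntegrable _ _)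
  set g : ℝ → ℝ := fun s => (deriv u s)^2 + (Wf p |u s| - E) with hg
  have hgi : ∀ a b, IntervalIntegrable g volume a b := fun a b =>
    (hd2i a b).add ((hWu.sub continuous_const).intervalIntegrable a b)
  have hgp : Function.Periodic g (2*π) := by
    intro x; simp only [hg]; rw [deriv_periodic u _ hper x, hper x]
  have hsq : ∀ s, f (u s)^2 = Wf p |u s| - E := fun s =>
    sq_sqrt (sub_nonneg.2 (Wf_ge p hp m M _ E hm hmE hME (hmin s) (hmax s)))
  have hA := area_key p hp m M E hm hm1 hM1 hmE hME
  have hAf : ∫ t in m..M, √(Wf p t - E) = ∫ t in m..M, f t := by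
    apply intervalIntegral.integral_congr
    intro t ht
    rw [Set.uIcc_of_le (by linarith)] at ht
    simp only [hf]
    rw [abs_of_nonneg (hm.trans ht.1)]
  have hI1 : 2 * ∫ t in m..M, f t ≤ ∫ s in x0..x1, g s := by
    rw [← hx0, ← hx1, ← hFTC, ← intervalIntegral.integral_const_mul]
    apply intervalIntegral.integral_mono_on h01 ((hfui _ _).const_mul 2) (hgi _ _)
    intro s _
    simp only [hg]
    rw [← hsq]
    nlinarith [sq_nonneg (deriv u s - f (u s))]
  have hI2 : 2 * ∫ t in m..M, f t ≤ ∫ s in x1..(x0+2*π), g s := by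
    have : ∫ t in m..M, f t = - ∫ s in x1..(x0+2*π), f (u s) * deriv u s := by
      rw [hFTC, hper x0, hx0, hx1, intervalIntegral.integral_symm]
    rw [this, mul_neg, ← intervalIntegral.integral_const_mul, ← intervalIntegral.integral_neg]
    apply intervalIntegral.integral_mono_on h12.le ((hfui _ _).const_mul 2).neg (hgi _ _)
    intro s _
    simp only [hg, Pi.neg_apply]
    rw [← hsq]
    nlinarith [sq_nonneg (deriv u s + f (u s))]
  have hI3 := intervalIntegral.integral_add_adjacent_intervals (hgi x0 x1) (hgi x1 (x0+2*π))
  have hI4 := hgp.intervalIntegral_add_eq x0 (-π)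
  rw [show -π + 2*π = π by ring] at hI4
  have hI5 : ∫ s in (-π)..π, g s = (∫ s in (-π)..π, (deriv u s)^2) + (∫ s in (-π)..π, Wf p |u s|) - 2*π*E := by
    simp only [hg]
    have hi : IntervalIntegrable (fun s => Wf p |u s| - E) volume (-π) π :=
      (hWu.sub continuous_const).intervalIntegrable _ _
    rw [intervalIntegral.integral_add hL2 hi,
      intervalIntegral.integral_sub (hWu.intervalIntegrable _ _) (by simp)]
    simp
    ring
  rw [hAf] at hA
  nlinarith

lemma young (p : ℝ) (hp : 2 < p) (X : ℝ) (hX : 0 ≤ X) : X^(2/p) ≤ 2/p * X + (1 - 2/p) := by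
  have hp0 : 0 < p := by linarith
  have h1 : 2/p ≤ 1 := by rw [div_le_one hp0]; linarith
  have := Real.geom_mean_le_arith_mean2_weighted (w₁ := 2/p) (w₂ := 1 - 2/p) (p₁ := X) (p₂ := 1)
    (by positivity) (by linarith) hX (by norm_num) (by ring)
  simpa using this

/-- strict inequality for normalised functions -/
lemma core2 (p : ℝ) (hp : 2 < p) (u : ℝ → ℝ) (hu : Continuous u) (hper : Function.Periodic u (2 * π))
    (hdiff : Differentiable ℝ u)
    (hL2 : IntervalIntegrable (fun s => (deriv u s) ^ 2) volume (-π) π)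
    (m M : ℝ) (hm : 0 ≤ m) (hmM : m < M) (hmin : ∀ s, m ≤ |u s|) (hmax : ∀ s, |u s| ≤ M)
    (hW : Wf p m = Wf p M)
    (x0 x1 : ℝ) (hx0 : u x0 = m) (hx1 : u x1 = M) :
    1/(p-2) * ((1 / (2 * π)) * ∫ s in (-π)..π, |u s| ^ p) ^ (2 / p)
      < (1 / (2 * π)) * (∫ s in (-π)..π, (deriv u s) ^ 2)
        + 1/(p-2) * ((1 / (2 * π)) * ∫ s in (-π)..π, (u s) ^ 2) := by
  have hq : 0 < p - 2 := by linarith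
  have hp0 : 0 < p := by linarith
  have hpi := Real.pi_pos
  have hm1 : m < 1 := by
    by_contra h
    push Not at h
    exact absurd hW (Wf_anti p hp h (Set.mem_Ici.2 (h.trans hmM.le)) hmM).ne'
  have hM1 : 1 < M := by
    by_contra h
    push Not at h
    exact absurd hW (Wf_mono p hp ⟨hm, hm1.le⟩ ⟨hm.trans hmM.le, h⟩ hmM).ne
  have hc := core p hp u hu hper hdiff hL2 m M (Wf p M) hm hm1 hM1 hW rfl hmin hmax x0 x1 hx0 hx1
  have hcp : Continuous (fun s => |u s|^p) := by
    exact (Real.continuous_rpow_const hp0.le).comp hu.abs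
  have hWint : ∫ s in (-π)..π, Wf p |u s| =
      ((∫ s in (-π)..π, (u s)^2) - 2/p * ∫ s in (-π)..π, |u s|^p)/(p-2) := by
    simp only [Wf, sq_abs]
    rw [intervalIntegral.integral_div, intervalIntegral.integral_sub, intervalIntegral.integral_const_mul]
    · exact (hu.pow 2).intervalIntegrable _ _
    · exact (hcp.const_mul _).intervalIntegrable _ _
  have hX0 : 0 ≤ ∫ s in (-π)..π, |u s|^p :=
    intervalIntegral.integral_nonneg (by linarith) (fun s _ => by positivity)
  rw [hWint, Wf_one] at hc
  generalize (∫ s in (-π)..π, |u s|^p) = X at *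
  generalize (∫ s in (-π)..π, (u s)^2) = Y at *
  generalize (∫ s in (-π)..π, (deriv u s)^2) = D at *
  have hy := young p hp (1/(2*π) * X) (by positivity)
  have h1 : 1/(p-2) * (1/(2*π) * X)^(2/p) ≤ 1/(p-2) * (2/p * (1/(2*π) * X) + (1 - 2/p)) :=
    mul_le_mul_of_nonneg_left hy (by positivity)
  have h2 := mul_lt_mul_of_pos_left hc (show 0 < 1/(2*π) by positivity)
  have h3 : 1/(2*π) * (2 * π * ((1 - 2/p)/(p-2))) = 1/(p-2) * (1 - 2/p) := by field_simp
  have h4 : 1/(2*π) * (D + (Y - 2/p * X)/(p-2)) = 1/(2*π)*D + 1/(p-2) * (1/(2*π) * Y) - 1/(p-2) * (2/p * (1/(2*π) * X)) := by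
    field_simp
    ring
  rw [h3, h4] at h2
  linarith

lemma core3 (p : ℝ) (hp : 2 < p) (u : ℝ → ℝ) (hu : Continuous u) (hper : Function.Periodic u (2 * π))
    (hdiff : Differentiable ℝ u)
    (hL2 : IntervalIntegrable (fun s => (deriv u s) ^ 2) volume (-π) π)
    (m M : ℝ) (hm : 0 ≤ m) (hmM : m < M) (hmin : ∀ s, m ≤ |u s|) (hmax : ∀ s, |u s| ≤ M)
    (x0 x1 : ℝ) (hx0 : u x0 = m) (hx1 : u x1 = M) :
    1/(p-2) * ((1 / (2 * π)) * ∫ s in (-π)..π, |u s| ^ p) ^ (2 / p)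
      < (1 / (2 * π)) * (∫ s in (-π)..π, (deriv u s) ^ 2)
        + 1/(p-2) * ((1 / (2 * π)) * ∫ s in (-π)..π, (u s) ^ 2) := by
  have hq : 0 < p - 2 := by linarith
  have hp0 : 0 < p := by linarith
  have hpi := Real.pi_pos
  have h2 : 0 < M^2 - m^2 := by nlinarith
  have h3 : 0 < M^p - m^p := sub_pos.2 (Real.rpow_lt_rpow hm hmM hp0)
  set A := p/2 * (M^2 - m^2)/(M^p - m^p) with hA
  have hA0 : 0 < A := by positivity
  set c := A^(1/(p-2)) with hcdef
  have hc : 0 < c := by positivity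
  have hcq : c^(p-2) = A := by
    rw [hcdef, ← rpow_mul hA0.le, one_div, inv_mul_cancel₀ hq.ne', rpow_one]
  have hcp : c^p = c^2 * A := by
    rw [← hcq, ← rpow_natCast, ← rpow_add hc]; norm_num
  have hW : Wf p (c*m) = Wf p (c*M) := by
    unfold Wf
    rw [mul_rpow hc.le hm, mul_rpow hc.le (hm.trans hmM.le), hcp]
    congr 1
    have : A * (M^p - m^p) = p/2 * (M^2 - m^2) := by rw [hA]; field_simp
    have h5 : 2/p * (A * (M^p - m^p)) = M^2 - m^2 := by rw [this]; field_simp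
    linear_combination (c^2) * h5
  have hd : ∀ s, deriv (fun s => c * u s) s = c * deriv u s := fun s => deriv_const_mul c (hdiff s)
  have key := core2 p hp (fun s => c * u s) (by fun_prop) (fun s => by simp only; rw [hper s])
    (by fun_prop) (by
      simp only [hd, mul_pow]; exact hL2.const_mul _) (c*m) (c*M) (by positivity)
      (by nlinarith) (fun s => by rw [abs_mul, abs_of_pos hc]; exact mul_le_mul_of_nonneg_left (hmin s) hc.le)
      (fun s => by rw [abs_mul, abs_of_pos hc]; exact mul_le_mul_of_nonneg_left (hmax s) hc.le)
      hW x0 x1 (by rw [hx0]) (by rw [hx1])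
  have e1 : ∀ s, |c * u s|^p = c^p * |u s|^p := fun s => by
    rw [abs_mul, abs_of_pos hc, mul_rpow hc.le (abs_nonneg _)]
  simp only [hd, e1, mul_pow, intervalIntegral.integral_const_mul] at key
  have hX0 : 0 ≤ ∫ s in (-π)..π, |u s|^p :=
    intervalIntegral.integral_nonneg (by linarith) (fun s _ => by positivity)
  rw [mul_left_comm (1/(2*π)) (c^p), mul_rpow (by positivity) (by positivity), ← rpow_mul hc.le,
    mul_div_cancel₀ _ hp0.ne', rpow_two] at key
  have hc2 : 0 < c^2 := by positivity
  refine lt_of_mul_lt_mul_left ?_ hc2.le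
  linarith

lemma core4 (p : ℝ) (hp : 2 < p) (u : ℝ → ℝ) (hu : Continuous u) (hper : Function.Periodic u (2 * π))
    (hdiff : Differentiable ℝ u)
    (hL2 : IntervalIntegrable (fun s => (deriv u s) ^ 2) volume (-π) π)
    (hnc : ¬ ∃ c : ℝ, ∀ s, u s = c) :
    1/(p-2) * ((1 / (2 * π)) * ∫ s in (-π)..π, |u s| ^ p) ^ (2 / p)
      < (1 / (2 * π)) * (∫ s in (-π)..π, (deriv u s) ^ 2)
        + 1/(p-2) * ((1 / (2 * π)) * ∫ s in (-π)..π, (u s) ^ 2) := by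
  have hpi := Real.pi_pos
  have hper' : ∀ s, ∃ y ∈ Set.Icc 0 (2*π), u s = u y := by
    intro s
    obtain ⟨y, hy, h⟩ := hper.exists_mem_Ico₀ (by positivity) s
    exact ⟨y, Set.Ico_subset_Icc_self hy, h⟩
  have hne : (Set.Icc 0 (2*π)).Nonempty := Set.nonempty_Icc.2 (by positivity)
  obtain ⟨x0, -, h0⟩ := isCompact_Icc.exists_isMinOn hne hu.abs.continuousOn
  obtain ⟨x1, -, h1⟩ := isCompact_Icc.exists_isMaxOn hne hu.abs.continuousOn
  have hmin : ∀ s, |u x0| ≤ |u s| := fun s => by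
    obtain ⟨y, hy, h⟩ := hper' s
    rw [h]; exact h0 hy
  have hmax : ∀ s, |u s| ≤ |u x1| := fun s => by
    obtain ⟨y, hy, h⟩ := hper' s
    rw [h]; exact h1 hy
  have hivt : ∀ a b, u a ≤ 0 → 0 ≤ u b → u x0 = 0 := by
    intro a b ha hb
    obtain ⟨y, hy⟩ := mem_range_of_exists_le_of_exists_ge hu ⟨a, ha⟩ ⟨b, hb⟩
    have := hmin y
    rw [hy, abs_zero] at this
    exact abs_nonpos_iff.1 this
  have hlt : |u x0| < |u x1| := by
    refine lt_of_le_of_ne (hmin x1) fun he => hnc ?_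
    have hall : ∀ s, |u s| = |u x0| := fun s => le_antisymm (he ▸ hmax s) (hmin s)
    by_cases h00 : u x0 = 0
    · exact ⟨0, fun s => by have := hall s; rwa [h00, abs_zero, abs_eq_zero] at this⟩
    · refine ⟨u x0, fun s => ?_⟩
      rcases abs_eq_abs.1 (hall s) with h | h
      · exact h
      · exfalso
        rcases le_total (u x0) 0 with h2 | h2
        · exact h00 (hivt x0 s h2 (by linarith))
        · exact h00 (hivt s x0 (by linarith) h2)
  rcases le_total 0 (u x1) with hs | hs
  · have hx0 : 0 ≤ u x0 := by
      by_contra h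
      push Not at h
      exact h.ne (hivt x0 x1 h.le hs)
    exact core3 p hp u hu hper hdiff hL2 |u x0| |u x1| (abs_nonneg _) hlt hmin hmax x0 x1
      (abs_of_nonneg hx0).symm (abs_of_nonneg hs).symm
  · have hx0 : u x0 ≤ 0 := by
      by_contra h
      push Not at h
      exact h.ne' (hivt x1 x0 hs h.le)
    have hd : ∀ s, deriv (fun s => - u s) s = - deriv u s := fun s => deriv.fun_neg
    have := core3 p hp (fun s => - u s) (by fun_prop) (fun s => by simp only; rw [hper s]) (by fun_prop)
      (by simpa only [hd, neg_sq] using hL2) |u x0| |u x1| (abs_nonneg _) hlt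
      (fun s => by rw [abs_neg]; exact hmin s) (fun s => by rw [abs_neg]; exact hmax s) x0 x1
      (abs_of_nonpos hx0).symm (abs_of_nonpos hs).symm
    simpa only [hd, neg_sq, abs_neg] using this

/-- sharp subcritical interpolation inequality on the circle:
for `p > 2` and `0 < β ≤ 1/(p-2)`,
`‖u'‖²_{L²} + β ‖u‖²_{L²} ≥ β ‖u‖²_{L^p}`, with equality only for constants. -/
theorem sharp_interpolation_circle (p β : ℝ) (hp : 2 < p)
    (hβ : 0 < β) (hβ' : β ≤ 1 / (p - 2))
    (u : ℝ → ℝ) (hu : Continuous u) (hper : Function.Periodic u (2 * π))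
    (hdiff : Differentiable ℝ u)
    (hL2 : IntervalIntegrable (fun s => (deriv u s) ^ 2) volume (-π) π) :
    β * ((1 / (2 * π)) * ∫ s in (-π)..π, |u s| ^ p) ^ (2 / p)
      ≤ (1 / (2 * π)) * (∫ s in (-π)..π, (deriv u s) ^ 2)
        + β * ((1 / (2 * π)) * ∫ s in (-π)..π, (u s) ^ 2)
    ∧ ((β * ((1 / (2 * π)) * ∫ s in (-π)..π, |u s| ^ p) ^ (2 / p)
      = (1 / (2 * π)) * (∫ s in (-π)..π, (deriv u s) ^ 2)
        + β * ((1 / (2 * π)) * ∫ s in (-π)..π, (u s) ^ 2))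
      → ∃ c : ℝ, ∀ s : ℝ, u s = c) := by
  have hq : 0 < p - 2 := by linarith
  have hp0 : 0 < p := by linarith
  have hpi := Real.pi_pos
  by_cases hc : ∃ c : ℝ, ∀ s, u s = c
  · refine ⟨?_, fun _ => hc⟩
    obtain ⟨c, hc⟩ := hc
    have hu' : u = fun _ => c := funext hc
    have e1 : (1 / (2 * π)) * ∫ s in (-π)..π, |u s| ^ p = |c|^p := by
      simp only [hc, intervalIntegral.integral_const, smul_eq_mul]
      field_simp; ring
    have e2 : (1 / (2 * π)) * ∫ s in (-π)..π, (u s) ^ 2 = c^2 := by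
      simp only [hc, intervalIntegral.integral_const, smul_eq_mul]
      field_simp; ring
    have e3 : ∫ s in (-π)..π, (deriv u s) ^ 2 = 0 := by
      rw [hu']; simp
    rw [e1, e2, e3, ← rpow_mul (abs_nonneg _), mul_div_cancel₀ _ hp0.ne', rpow_two, sq_abs]
    simp
  · have key := core4 p hp u hu hper hdiff hL2 hc
    have hD : 0 ≤ (1 / (2 * π)) * ∫ s in (-π)..π, (deriv u s) ^ 2 :=
      mul_nonneg (by positivity) (intervalIntegral.integral_nonneg (by linarith) fun s _ => by positivity)
    have hlt : β * ((1 / (2 * π)) * ∫ s in (-π)..π, |u s| ^ p) ^ (2 / p)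
      < (1 / (2 * π)) * (∫ s in (-π)..π, (deriv u s) ^ 2)
        + β * ((1 / (2 * π)) * ∫ s in (-π)..π, (u s) ^ 2) := by
      generalize ((1 / (2 * π)) * ∫ s in (-π)..π, |u s| ^ p) ^ (2 / p) = X at *
      generalize (1 / (2 * π)) * ∫ s in (-π)..π, (u s) ^ 2 = Y at *
      generalize (1 / (2 * π)) * ∫ s in (-π)..π, (deriv u s) ^ 2 = D at *
      have h1 : β * (p-2) ≤ 1 := by rwa [le_div_iff₀ hq] at hβ'
      have h2 : X < (p-2) * D + Y := by
        field_simp at key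
        linarith
      have h3 := mul_lt_mul_of_pos_left h2 hβ
      nlinarith
    exact ⟨hlt.le, fun h => absurd h hlt.ne⟩
end

section
/- (Rigidity region) Let p > 2, a ∈ [0,1/2], α > -a², and assume a²(p+2) + α(p-2) ≤ 1. Then for every positive u ∈ H¹(S¹), ‖u'‖²_{L²} + a²·(‖u^{-1}‖²_{L²})^{-1} + α‖u‖²_{L²} ≥ (a² + α)‖u‖²_{L^p}, with equality only for constant functions. -/
open Real MeasureTheory


section Helpers
open Filter Topology

lemma wirt {a b : ℝ} (hab : a < b) {f f' : ℝ → ℝ} (hf : ∀ x, HasDerivAt f (f' x) x)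
    (hper : f b = f a) (hsq : IntervalIntegrable (fun x => (f' x) ^ 2) volume a b)
    (hmean : ∫ x in a..b, f x = 0) :
    (2 * π / (b - a)) ^ 2 * ∫ x in a..b, (f x) ^ 2 ≤ ∫ x in a..b, (f' x) ^ 2 := by
  have hcont : Continuous f := continuous_iff_continuousAt.2 fun x => (hf x).continuousAt
  have hba : 0 < b - a := by linarith
  have hder : f' = deriv f := funext fun x => (hf x).deriv.symm
  have hL2 : MemLp f' 2 (volume.restrict (Set.Ioc a b)) := by
    rw [memLp_two_iff_integrable_sq]
    · rwa [intervalIntegrable_iff_integrableOn_Ioc_of_le hab.le] at hsq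
    · rw [hder]; exact (measurable_deriv f).aestronglyMeasurable
  have hint : IntervalIntegrable f' volume a b := by
    rw [intervalIntegrable_iff_integrableOn_Ioc_of_le hab.le]
    exact hL2.integrable (by norm_num)
  have hfL2 : MemLp (fun x => (f x : ℂ)) 2 (volume.restrict (Set.Ioc a b)) := by
    have : MemLp f 2 (volume.restrict (Set.Ioc a b)) := by
      rw [memLp_two_iff_integrable_sq hcont.aestronglyMeasurable]
      have : IntervalIntegrable (fun x => (f x) ^ 2) volume a b :=
        (hcont.pow 2).intervalIntegrable _ _
      rwa [intervalIntegrable_iff_integrableOn_Ioc_of_le hab.le] at this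
    exact this.ofReal
  have h1 := hasSum_sq_fourierCoeffOn hab hfL2
  have h2 := hasSum_sq_fourierCoeffOn hab (hL2.ofReal (K := ℂ))
  have h0 : fourierCoeffOn hab (fun x => (f x : ℂ)) 0 = 0 := by
    rw [fourierCoeffOn_eq_integral]
    simp [intervalIntegral.integral_ofReal, hmean]
  have key : ∀ n : ℤ, (2 * π / (b - a)) ^ 2 * ‖fourierCoeffOn hab (fun x => (f x : ℂ)) n‖ ^ 2 ≤
      ‖fourierCoeffOn hab (fun x => (f' x : ℂ)) n‖ ^ 2 := by
    intro n
    by_cases hn : n = 0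
    · subst hn; rw [h0]; simp
    have := fourierCoeffOn_of_hasDerivAt hab (f := fun x => (f x : ℂ)) (f' := fun x => (f' x : ℂ))
      hn (fun x _ => (hf x).ofReal_comp) ⟨hint.1.ofReal, hint.2.ofReal⟩
    rw [this, hper]
    have hn1 : (1 : ℝ) ≤ |(n : ℝ)| := by exact_mod_cast Int.one_le_abs hn
    have e1 : ‖(1 : ℂ) / (-2 * π * Complex.I * n)‖ = 1 / (2 * π * |(n : ℝ)|) := by
      simp [abs_of_pos pi_pos]
    simp only [sub_self, mul_zero, zero_sub]
    rw [norm_mul, e1, norm_neg, norm_mul]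
    have e2 : ‖((b : ℂ) - a)‖ = b - a := by
      rw [← Complex.ofReal_sub, Complex.norm_real, Real.norm_of_nonneg hba.le]
    rw [e2]
    set y := ‖fourierCoeffOn hab (fun x => (f' x : ℂ)) n‖
    have : (2 * π / (b - a)) ^ 2 * (1 / (2 * π * |(n : ℝ)|) * ((b - a) * y)) ^ 2
      = (1 / |(n : ℝ)| * y) ^ 2 := by
      have := pi_pos
      field_simp
    rw [this]
    have hy : 0 ≤ y := norm_nonneg _
    have : 1 / |(n : ℝ)| ≤ 1 := by rw [div_le_one (by linarith)]; exact hn1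
    gcongr
    nlinarith
  have := hasSum_le key (h1.mul_left _) h2
  simp only [Complex.norm_real, smul_eq_mul, Real.norm_eq_abs, sq_abs, RCLike.norm_ofReal] at this
  have hi : 0 < (b - a)⁻¹ := inv_pos.2 hba
  rw [mul_left_comm] at this
  exact le_of_mul_le_mul_left this hi

lemma anti_wirt {f f' : ℝ → ℝ} (hf : ∀ x, HasDerivAt f (f' x) x)
    (hanti : ∀ x, f (x + 2 * π) = - f x)
    (hsq : IntervalIntegrable (fun x => (f' x) ^ 2) volume (-π) π) :
    ∫ x in (-π)..π, (f x) ^ 2 ≤ 4 * ∫ x in (-π)..π, (f' x) ^ 2 := by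
  have hcont : Continuous f := continuous_iff_continuousAt.2 fun x => (hf x).continuousAt
  have hpi := pi_pos
  have hanti' : ∀ x, f' (x + 2 * π) = - f' x := by
    intro x
    have h1 : HasDerivAt (fun y => f (y + 2 * π)) (f' (x + 2 * π)) x :=
      (hf (x + 2 * π)).comp_add_const x (2 * π)
    have h2 : HasDerivAt (fun y => f (y + 2 * π)) (- f' x) x := by
      simp_rw [hanti]; exact (hf x).neg
    exact h1.unique h2
  have p1 : Function.Periodic (fun x => (f x) ^ 2) (2 * π) := fun x => by simp [hanti]
  have p2 : Function.Periodic (fun x => (f' x) ^ 2) (2 * π) := fun x => by simp [hanti']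
  have e3 : (3 * π) = π + 2 * π := by ring
  have e1 : (-π + 2 * π) = π := by ring
  have i2 : ∀ x y, IntervalIntegrable (fun x => (f' x) ^ 2) volume x y := by
    intro x y
    refine p2.intervalIntegrable (t := -π) (by positivity) ?_ x y
    rwa [e1]
  have dbl : ∀ g : ℝ → ℝ, Function.Periodic g (2 * π) →
      (∀ x y, IntervalIntegrable g volume x y) →
      ∫ x in (-π)..(3 * π), g x = 2 * ∫ x in (-π)..π, g x := by
    intro g hg hi
    rw [← intervalIntegral.integral_add_adjacent_intervals (hi (-π) π) (hi π (3 * π)), e3,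
      hg.intervalIntegral_add_eq π (-π), e1]; ring
  have hm : ∫ x in (-π)..(3 * π), f x = 0 := by
    rw [← intervalIntegral.integral_add_adjacent_intervals (hcont.intervalIntegrable (-π) π)
      (hcont.intervalIntegrable π (3 * π))]
    have : ∫ x in π..(3 * π), f x = ∫ x in (-π)..π, f (x + 2 * π) := by
      rw [intervalIntegral.integral_comp_add_right]; rw [e1, e3]
    rw [this]; simp_rw [hanti]; simp
  have := wirt (a := -π) (b := 3 * π) (by linarith) hf
    (by rw [show 3 * π = (-π + 2 * π) + 2 * π by ring, hanti, hanti]; ring) (i2 _ _) hm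
  rw [dbl _ p1 (fun x y => (hcont.pow 2).intervalIntegrable x y), dbl _ p2 i2] at this
  have e : (2 * π / (3 * π - -π)) ^ 2 = 1 / 4 := by
    field_simp; ring
  rw [e] at this
  linarith

lemma EHL {u : ℝ → ℝ} (hper : Function.Periodic u (2 * π))
    (hpos : ∀ s, 0 < u s) (hdiff : Differentiable ℝ u)
    (hL2 : IntervalIntegrable (fun s => (deriv u s) ^ 2) volume (-π) π) :
    ∫ s in (-π)..π, (u s) ^ 2 ≤ 4 * (∫ s in (-π)..π, (deriv u s) ^ 2)
      + 4 * π ^ 2 * (∫ s in (-π)..π, (u s)⁻¹ ^ 2)⁻¹ := by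
  have hpi := pi_pos
  have hu := hdiff.continuous
  have hw : Continuous (fun s => (u s)⁻¹ ^ 2) := (hu.inv₀ fun s => (hpos s).ne').pow 2
  have hK : 0 < ∫ s in (-π)..π, (u s)⁻¹ ^ 2 := by
    refine intervalIntegral.intervalIntegral_pos_of_pos (hw.intervalIntegrable _ _) ?_ (by linarith)
    intro s; have := hpos s; positivity
  set K := ∫ s in (-π)..π, (u s)⁻¹ ^ 2 with hKdef
  set φ : ℝ → ℝ := fun s => π / K * ∫ t in (-π)..s, (u t)⁻¹ ^ 2 with hφ
  have dφ : ∀ s, HasDerivAt φ (π / K * (u s)⁻¹ ^ 2) s := fun s =>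
    (intervalIntegral.integral_hasDerivAt_right (hw.intervalIntegrable _ _)
      hw.aestronglyMeasurable.stronglyMeasurableAtFilter hw.continuousAt).const_mul _
  have pw : Function.Periodic (fun s => (u s)⁻¹ ^ 2) (2 * π) := fun s => by simp [hper s]
  have aφ : ∀ s, φ (s + 2 * π) = φ s + π := by
    intro s
    simp only [hφ]
    rw [← intervalIntegral.integral_add_adjacent_intervals (hw.intervalIntegrable (-π) s)
      (hw.intervalIntegrable s _), pw.intervalIntegral_add_eq s (-π),
      show -π + 2 * π = π by ring, ← hKdef]
    field_simp
  have hφc : Continuous φ := continuous_iff_continuousAt.2 fun x => (dφ x).continuousAt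
  have df : ∀ s, HasDerivAt (fun s => u s * cos (φ s))
      (deriv u s * cos (φ s) + u s * (-sin (φ s) * (π / K * (u s)⁻¹ ^ 2))) s := fun s =>
    (hdiff s).hasDerivAt.mul (dφ s).cos
  have dg : ∀ s, HasDerivAt (fun s => u s * sin (φ s))
      (deriv u s * sin (φ s) + u s * (cos (φ s) * (π / K * (u s)⁻¹ ^ 2))) s := fun s =>
    (hdiff s).hasDerivAt.mul (dφ s).sin
  have du1 : IntervalIntegrable (deriv u) volume (-π) π := by
    rw [intervalIntegrable_iff_integrableOn_Ioc_of_le (by linarith)] at hL2 ⊢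
    have : MemLp (deriv u) 2 (volume.restrict (Set.Ioc (-π) π)) := by
      rw [memLp_two_iff_integrable_sq (measurable_deriv u).aestronglyMeasurable]; exact hL2
    exact this.integrable (by norm_num)
  have gen : ∀ (c d : ℝ → ℝ), Continuous c → Continuous d →
      IntervalIntegrable (fun s => (deriv u s * c s + d s) ^ 2) volume (-π) π := by
    intro c d hc hd
    have := ((hL2.mul_continuousOn (hc.pow 2).continuousOn).add
      (du1.mul_continuousOn ((hc.mul hd).const_smul (2:ℝ)).continuousOn)).add
      ((hd.pow 2).intervalIntegrable (-π) π)
    refine this.congr ?_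
    intro s _
    simp; ring
  have cc : Continuous (fun s => cos (φ s)) := continuous_cos.comp hφc
  have cs : Continuous (fun s => sin (φ s)) := continuous_sin.comp hφc
  have if' := gen _ (fun s => u s * (-sin (φ s) * (π / K * (u s)⁻¹ ^ 2))) cc (by fun_prop)
  have ig' := gen _ (fun s => u s * (cos (φ s) * (π / K * (u s)⁻¹ ^ 2))) cs (by fun_prop)
  have h1 := anti_wirt df (fun s => by simp only [aφ, hper s, cos_add_pi]; ring) if'
  have h2 := anti_wirt dg (fun s => by simp only [aφ, hper s, sin_add_pi]; ring) ig'
  have s1 : ∫ s in (-π)..π, (u s) ^ 2 = (∫ s in (-π)..π, (u s * cos (φ s)) ^ 2) +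
      ∫ s in (-π)..π, (u s * sin (φ s)) ^ 2 := by
    rw [← intervalIntegral.integral_add (Continuous.intervalIntegrable (by fun_prop) _ _)
      (Continuous.intervalIntegrable (by fun_prop) _ _)]
    congr 1; ext s; nlinarith [sin_sq_add_cos_sq (φ s)]
  have s2 := intervalIntegral.integral_add if' ig'
  have s3 : (∫ s in (-π)..π, (deriv u s) ^ 2) + π ^ 2 / K ^ 2 * K =
    ∫ s in (-π)..π, ((deriv u s * cos (φ s) + u s * (-sin (φ s) * (π / K * (u s)⁻¹ ^ 2))) ^ 2
     + (deriv u s * sin (φ s) + u s * (cos (φ s) * (π / K * (u s)⁻¹ ^ 2))) ^ 2) := by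
    conv_lhs => rw [hKdef]
    rw [← hKdef, ← intervalIntegral.integral_const_mul, ← intervalIntegral.integral_add hL2
      (Continuous.intervalIntegrable (by fun_prop) _ _)]
    congr 1; ext s
    have h := sin_sq_add_cos_sq (φ s)
    have hs := (hpos s).ne'
    have : (deriv u s * cos (φ s) + u s * (-sin (φ s) * (π / K * (u s)⁻¹ ^ 2))) ^ 2
     + (deriv u s * sin (φ s) + u s * (cos (φ s) * (π / K * (u s)⁻¹ ^ 2))) ^ 2 =
     (sin (φ s) ^ 2 + cos (φ s) ^ 2) * (deriv u s ^ 2 + (u s * (π / K * (u s)⁻¹ ^ 2)) ^ 2) := by ring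
    rw [this, h]
    field_simp
  have s4 : π ^ 2 / K ^ 2 * K = π ^ 2 * K⁻¹ := by field_simp
  rw [s4, s2] at s3
  linarith

lemma int_deriv_zero {F F' : ℝ → ℝ} (h : ∀ x, HasDerivAt F (F' x) x) (hc : Continuous F')
    (hp : F π = F (-π)) : ∫ x in (-π)..π, F' x = 0 := by
  rw [intervalIntegral.integral_eq_sub_of_hasDerivAt (fun x _ => h x) (hc.intervalIntegrable _ _),
    hp, sub_self]

lemma cs_int {f g : ℝ → ℝ} (hf : Continuous f) (hg : Continuous g) (hg0 : ∀ x, 0 < g x) :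
    (∫ x in (-π)..π, (f x) ^ 2) ^ 2 / (∫ x in (-π)..π, (g x) ^ 2) ≤
      ∫ x in (-π)..π, (f x) ^ 4 / (g x) ^ 2 := by
  have hpi := pi_pos
  have hE : 0 < ∫ x in (-π)..π, (g x) ^ 2 := by
    refine intervalIntegral.intervalIntegral_pos_of_pos
      (Continuous.intervalIntegrable (by fun_prop) _ _) ?_ (by linarith)
    intro s; have := hg0 s; positivity
  set E := ∫ x in (-π)..π, (g x) ^ 2 with hEd
  set I := ∫ x in (-π)..π, (f x) ^ 2 with hId
  have c4 : Continuous (fun x => (f x) ^ 4 / (g x) ^ 2) :=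
    (hf.pow 4).div (hg.pow 2) (fun x => (pow_pos (hg0 x) 2).ne')
  have h : ∫ x in (-π)..π, (2 * (I / E) * (f x) ^ 2 - (I / E) ^ 2 * (g x) ^ 2) ≤
      ∫ x in (-π)..π, (f x) ^ 4 / (g x) ^ 2 := by
    refine intervalIntegral.integral_mono_on (by linarith)
      (Continuous.intervalIntegrable (by fun_prop) _ _) (c4.intervalIntegrable _ _) ?_
    intro x _
    have := hg0 x
    rw [le_div_iff₀ (by positivity)]
    nlinarith [sq_nonneg (f x ^ 2 - I / E * g x ^ 2)]
  rw [intervalIntegral.integral_sub (Continuous.intervalIntegrable (by fun_prop) _ _)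
    (Continuous.intervalIntegrable (by fun_prop) _ _), intervalIntegral.integral_const_mul,
    intervalIntegral.integral_const_mul, ← hEd, ← hId] at h
  have : 2 * (I / E) * I - (I / E) ^ 2 * E = I ^ 2 / E := by field_simp; ring
  linarith

lemma static {p : ℝ} (hp : 2 < p) {U U1 U2 Ut U1t : ℝ → ℝ} (hU : ∀ x, 0 < U x)
    (h0 : ∀ x, HasDerivAt U (U1 x) x) (h1 : ∀ x, HasDerivAt U1 (U2 x) x)
    (ht : ∀ x, HasDerivAt Ut (U1t x) x)
    (c2 : Continuous U2) (ct : Continuous U1t)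
    (eq : ∀ x, Ut x = U2 x + (p - 1) * (U1 x) ^ 2 / U x)
    (p0 : U π = U (-π)) (p1 : U1 π = U1 (-π)) (p2 : U2 π = U2 (-π)) :
    (∫ x in (-π)..π, 2 * U x * Ut x = 2 * (p - 2) * ∫ x in (-π)..π, (U1 x) ^ 2) ∧
    ((∫ x in (-π)..π, 2 * U1 x * U1t x) ≤ - 2 * (∫ x in (-π)..π, (U1 x) ^ 2)
      - (2 * (p - 1) / 3) * ((∫ x in (-π)..π, (U1 x) ^ 2) ^ 2 / ∫ x in (-π)..π, (U x) ^ 2)) := by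
  have hpi := pi_pos
  have c0 : Continuous U := continuous_iff_continuousAt.2 fun x => (h0 x).continuousAt
  have c1 : Continuous U1 := continuous_iff_continuousAt.2 fun x => (h1 x).continuousAt
  have cUt : Continuous Ut := continuous_iff_continuousAt.2 fun x => (ht x).continuousAt
  have hne : ∀ x, U x ≠ 0 := fun x => (hU x).ne'
  have cA : Continuous (fun x => U1 x ^ 4 / U x ^ 2) :=
    (c1.pow 4).div (c0.pow 2) (fun x => pow_ne_zero 2 (hne x))
  have cB : Continuous (fun x => U1 x ^ 2 * U2 x / U x) := ((c1.pow 2).mul c2).div c0 hne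
  have pt : Ut π = Ut (-π) := by rw [eq, eq, p0, p1, p2]
  constructor
  · have z := int_deriv_zero (F := fun x => U x * U1 x) (F' := fun x => U1 x * U1 x + U x * U2 x)
      (fun x => (h0 x).mul (h1 x)) (by fun_prop) (by simp [p0, p1])
    have : ∫ x in (-π)..π, 2 * U x * Ut x = ∫ x in (-π)..π,
      (2 * (p - 2) * U1 x ^ 2 + 2 * (U1 x * U1 x + U x * U2 x)) := by
      congr 1; ext x; rw [eq]; have := hne x; field_simp; ring
    rw [this, intervalIntegral.integral_add (Continuous.intervalIntegrable (by fun_prop) _ _)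
      (Continuous.intervalIntegrable (by fun_prop) _ _), intervalIntegral.integral_const_mul,
      intervalIntegral.integral_const_mul, z]; ring
  · have z1 := int_deriv_zero (F := fun x => U1 x * Ut x) (F' := fun x => U2 x * Ut x + U1 x * U1t x)
      (fun x => (h1 x).mul (ht x)) (by fun_prop) (by simp [pt, p1])
    have z2 := int_deriv_zero (F := fun x => U1 x ^ 3 / U x)
      (F' := fun x => 3 * (U1 x ^ 2 * U2 x / U x) - U1 x ^ 4 / U x ^ 2)
      (fun x => by
        convert! ((h1 x).fun_pow 3).fun_div (h0 x) (hne x) using 1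
        have := hne x
        field_simp; push_cast; ring) (by fun_prop) (by simp [p0, p1])
    have w := wirt (a := -π) (b := π) (by linarith) h1 p1
      (Continuous.intervalIntegrable (by fun_prop) _ _) (int_deriv_zero h0 c1 p0)
    have e1 : (2 * π / (π - -π)) ^ 2 = 1 := by
      rw [show π - -π = 2 * π by ring, div_self (by positivity)]; norm_num
    rw [e1, one_mul] at w
    have cs := cs_int c1 c0 hU
    have : ∫ x in (-π)..π, 2 * U1 x * U1t x = ∫ x in (-π)..π,
      (2 * (U2 x * Ut x + U1 x * U1t x) - 2 * U2 x ^ 2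
        - 2 * (p - 1) / 3 * (3 * (U1 x ^ 2 * U2 x / U x) - U1 x ^ 4 / U x ^ 2)
        - 2 * (p - 1) / 3 * (U1 x ^ 4 / U x ^ 2)) := by
      congr 1; ext x; rw [eq]; have := hne x; field_simp; ring
    rw [this]
    rw [intervalIntegral.integral_sub (Continuous.intervalIntegrable (by fun_prop) _ _)
      (Continuous.intervalIntegrable (by fun_prop) _ _),
      intervalIntegral.integral_sub (Continuous.intervalIntegrable (by fun_prop) _ _)
      (Continuous.intervalIntegrable (by fun_prop) _ _),
      intervalIntegral.integral_sub (Continuous.intervalIntegrable (by fun_prop) _ _)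
      (Continuous.intervalIntegrable (by fun_prop) _ _)]
    simp only [intervalIntegral.integral_const_mul]
    rw [z1, z2]
    have : 0 ≤ 2 * (p - 1) / 3 := by linarith
    nlinarith [mul_le_mul_of_nonneg_left cs this]

lemma param_cont {F : ℝ → ℝ → ℝ} {a b : ℝ} (hc : Continuous fun z : ℝ × ℝ => F (max z.1 0) z.2) :
    ContinuousOn (fun t => ∫ x in a..b, F t x) (Set.Ici 0) := by
  have : Continuous (fun t => ∫ x in a..b, F (max t 0) x) :=
    intervalIntegral.continuous_parametric_intervalIntegral_of_continuous' (f := fun t x => F (max t 0) x)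
      hc a b
  refine this.continuousOn.congr ?_
  intro t ht
  simp only [max_eq_left (Set.mem_Ici.1 ht)]

lemma param_deriv {F F' : ℝ → ℝ → ℝ} {a b t₀ : ℝ} (ht₀ : 0 < t₀)
    (hd : ∀ t, 0 < t → ∀ x, HasDerivAt (fun t => F t x) (F' t x) t)
    (hc : Continuous fun z : ℝ × ℝ => F (max z.1 0) z.2)
    (hc' : Continuous fun z : ℝ × ℝ => F' (max z.1 0) z.2) :
    HasDerivAt (fun t => ∫ x in a..b, F t x) (∫ x in a..b, F' t₀ x) t₀ := by
  have sl : ∀ {G : ℝ → ℝ → ℝ}, (Continuous fun z : ℝ × ℝ => G (max z.1 0) z.2) →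
      ∀ t, 0 < t → Continuous (G t) := by
    intro G hG t ht
    have := hG.comp (by fun_prop : Continuous fun x : ℝ => (t, x))
    simpa [Function.comp_def, max_eq_left ht.le] using this
  obtain ⟨C, hC⟩ := ((isCompact_Icc (a := t₀ / 2) (b := 2 * t₀)).prod
    (isCompact_uIcc (a := a) (b := b))).exists_bound_of_continuousOn hc'.continuousOn
  have nh : Set.Ioo (t₀ / 2) (2 * t₀) ∈ nhds t₀ := Ioo_mem_nhds (by linarith) (by linarith)
  refine (intervalIntegral.hasDerivAt_integral_of_dominated_loc_of_deriv_le
    (bound := fun _ => C) nh ?_ ((sl hc t₀ ht₀).intervalIntegrable _ _)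
    (sl hc' t₀ ht₀).aestronglyMeasurable ?_ intervalIntegrable_const ?_).2
  · filter_upwards [lt_mem_nhds ht₀] with t ht
    exact (sl hc t ht).aestronglyMeasurable
  · filter_upwards with x hx t ht
    have := hC (t, x) ⟨⟨ht.1.le, ht.2.le⟩, Set.uIoc_subset_uIcc hx⟩
    have h0 : 0 < t := by linarith [ht.1]
    simpa [max_eq_left h0.le] using this
  · filter_upwards with x hx t ht
    exact hd t (by linarith [ht.1]) x

set_option maxHeartbeats 2000000 in
lemma flow {p : ℝ} (hp : 2 < p) {v v1 v2 v3 : ℝ → ℝ → ℝ} {m M c : ℝ} (hm : 0 < m)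
    (hv : ∀ t, 0 ≤ t → ∀ x, m ≤ v t x) (hM : ∀ t, 0 ≤ t → ∀ x, v t x ≤ M)
    (hM1 : ∀ t, 0 ≤ t → ∀ x, |v1 t x| ≤ M)
    (cv : Continuous fun z : ℝ × ℝ => v z.1 z.2) (cv1 : Continuous fun z : ℝ × ℝ => v1 z.1 z.2)
    (cv2 : Continuous fun z : ℝ × ℝ => v2 z.1 z.2) (cv3 : Continuous fun z : ℝ × ℝ => v3 z.1 z.2)
    (dx : ∀ t x, HasDerivAt (v t) (v1 t x) x) (dx1 : ∀ t x, HasDerivAt (v1 t) (v2 t x) x)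
    (dx2 : ∀ t x, HasDerivAt (v2 t) (v3 t x) x)
    (dt : ∀ t x, HasDerivAt (fun t => v t x) (v2 t x) t)
    (dt1 : ∀ t x, HasDerivAt (fun t => v1 t x) (v3 t x) t)
    (p0 : ∀ t, v t π = v t (-π)) (p1 : ∀ t, v1 t π = v1 t (-π)) (p2 : ∀ t, v2 t π = v2 t (-π))
    (lim : ∀ x, Tendsto (fun t => v t x) atTop (𝓝 c))
    (lim1 : ∀ x, Tendsto (fun t => v1 t x) atTop (𝓝 0)) :
    (∫ x in (-π)..π, (v 0 x ^ (1 / p)) ^ 2) ≤ 2 * π * (c ^ (1 / p)) ^ 2 ∧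
    (2 * π * (c ^ (1 / p)) ^ 2 - ∫ x in (-π)..π, (v 0 x ^ (1 / p)) ^ 2) / (p - 2) +
      (p - 1) / (6 * (p - 2) ^ 2) / (2 * π * (c ^ (1 / p)) ^ 2) *
      (2 * π * (c ^ (1 / p)) ^ 2 - ∫ x in (-π)..π, (v 0 x ^ (1 / p)) ^ 2) ^ 2 ≤
    ∫ x in (-π)..π, (1 / p * v 0 x ^ (1 / p - 1) * v1 0 x) ^ 2 := by
  have hpi := pi_pos
  have hp0 : 0 < p := by linarith
  set q := 1 / p with hq
  have hq0 : 0 < q := by positivity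
  have hpq : p = 1 / q := by rw [hq]; field_simp
  have vpos : ∀ t, 0 ≤ t → ∀ x, 0 < v t x := fun t ht x => hm.trans_le (hv t ht x)
  have hc : 0 < c := hm.trans_le (ge_of_tendsto (lim 0) (by
    filter_upwards [eventually_ge_atTop 0] with t ht using hv t ht 0))
  -- max versions
  have mx : Continuous (fun z : ℝ × ℝ => ((max z.1 0, z.2) : ℝ × ℝ)) := by fun_prop
  have cw : Continuous fun z : ℝ × ℝ => v (max z.1 0) z.2 := cv.comp mx
  have cw1 : Continuous fun z : ℝ × ℝ => v1 (max z.1 0) z.2 := cv1.comp mx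
  have cw2 : Continuous fun z : ℝ × ℝ => v2 (max z.1 0) z.2 := cv2.comp mx
  have cw3 : Continuous fun z : ℝ × ℝ => v3 (max z.1 0) z.2 := cv3.comp mx
  have cr : ∀ r : ℝ, Continuous fun z : ℝ × ℝ => v (max z.1 0) z.2 ^ r := fun r =>
    cw.rpow_const fun z => Or.inl (vpos _ (le_max_right _ _) _).ne'
  have cr0 := cr q
  have cr1 := cr (q - 1)
  have cr2 := cr (q - 2)
  set U : ℝ → ℝ → ℝ := fun t x => v t x ^ q with hU
  set U1 : ℝ → ℝ → ℝ := fun t x => q * v t x ^ (q - 1) * v1 t x with hU1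
  set U2 : ℝ → ℝ → ℝ := fun t x => q * ((q - 1) * v t x ^ (q - 2) * v1 t x) * v1 t x +
    q * v t x ^ (q - 1) * v2 t x with hU2
  set Ut : ℝ → ℝ → ℝ := fun t x => q * v t x ^ (q - 1) * v2 t x with hUt
  set U1t : ℝ → ℝ → ℝ := fun t x => q * ((q - 1) * v t x ^ (q - 2) * v1 t x) * v2 t x +
    q * v t x ^ (q - 1) * v3 t x with hU1t
  have cU : Continuous fun z : ℝ × ℝ => U (max z.1 0) z.2 := cr0
  have cU1 : Continuous fun z : ℝ × ℝ => U1 (max z.1 0) z.2 := by simp only [hU1]; fun_prop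
  have cU2 : Continuous fun z : ℝ × ℝ => U2 (max z.1 0) z.2 := by simp only [hU2]; fun_prop
  have cUt : Continuous fun z : ℝ × ℝ => Ut (max z.1 0) z.2 := by simp only [hUt]; fun_prop
  have cU1t : Continuous fun z : ℝ × ℝ => U1t (max z.1 0) z.2 := by simp only [hU1t]; fun_prop
  have sl : ∀ {G : ℝ → ℝ → ℝ}, (Continuous fun z : ℝ × ℝ => G (max z.1 0) z.2) →
      ∀ t, 0 ≤ t → Continuous (G t) := by
    intro G hG t ht
    have := hG.comp (by fun_prop : Continuous fun x : ℝ => (t, x))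
    simpa [Function.comp_def, max_eq_left ht] using this
  have gd : ∀ (f : ℝ → ℝ) (f' y r : ℝ), 0 < f y → HasDerivAt f f' y →
      HasDerivAt (fun y => f y ^ r) (r * f y ^ (r - 1) * f') y := by
    intro f f' y r h0 h
    convert! h.rpow_const (p := r) (Or.inl h0.ne') using 1; ring
  have gd1 : ∀ (f : ℝ → ℝ) (f' y : ℝ), 0 < f y → HasDerivAt f f' y →
      HasDerivAt (fun y => q * f y ^ (q - 1)) (q * ((q - 1) * f y ^ (q - 2) * f')) y := by
    intro f f' y h0 h
    have := (gd f f' y (q - 1) h0 h).const_mul q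
    rwa [show q - 1 - 1 = q - 2 by ring] at this
  have DUx : ∀ t, 0 < t → ∀ x, HasDerivAt (U t) (U1 t x) x := fun t ht x =>
    gd _ _ _ _ (vpos t ht.le x) (dx t x)
  have DU1x : ∀ t, 0 < t → ∀ x, HasDerivAt (U1 t) (U2 t x) x := fun t ht x =>
    (gd1 _ _ _ (vpos t ht.le x) (dx t x)).mul (dx1 t x)
  have DUtx : ∀ t, 0 < t → ∀ x, HasDerivAt (Ut t) (U1t t x) x := fun t ht x =>
    (gd1 _ _ _ (vpos t ht.le x) (dx t x)).mul (dx2 t x)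
  have DUt : ∀ t, 0 < t → ∀ x, HasDerivAt (fun t => U t x) (Ut t x) t := fun t ht x =>
    gd _ _ _ _ (vpos t ht.le x) (dt t x)
  have DU1t : ∀ t, 0 < t → ∀ x, HasDerivAt (fun t => U1 t x) (U1t t x) t := fun t ht x => by
    have := (gd1 (fun t => v t x) _ t (vpos t ht.le x) (dt t x)).mul (dt1 t x)
    convert! this using 1
    simp only [hU1t]; ring
  have eqn : ∀ t, 0 < t → ∀ x, Ut t x = U2 t x + (p - 1) * (U1 t x) ^ 2 / U t x := by
    intro t ht x
    have h := vpos t ht.le x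
    simp only [hUt, hU2, hU1, hU]
    rw [show q - 2 = q + (-2 : ℝ) by ring, show q - 1 = q + (-1 : ℝ) by ring, rpow_add h, rpow_add h,
      rpow_neg h.le, rpow_neg h.le, rpow_one, rpow_two, hpq]
    have : 0 < v t x ^ q := by positivity
    field_simp
    ring
  set e : ℝ → ℝ := fun t => ∫ x in (-π)..π, U t x ^ 2 with he
  set i : ℝ → ℝ := fun t => ∫ x in (-π)..π, U1 t x ^ 2 with hi
  have De : ∀ t, 0 < t → HasDerivAt e (∫ x in (-π)..π, 2 * U t x * Ut t x) t := fun t ht =>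
    param_deriv (F := fun t x => U t x ^ 2) (F' := fun t x => 2 * U t x * Ut t x) ht
      (fun t ht x => by convert! (DUt t ht x).fun_pow 2 using 1; simp) (cU.pow 2) ((continuous_const.mul cU).mul cUt)
  have Di : ∀ t, 0 < t → HasDerivAt i (∫ x in (-π)..π, 2 * U1 t x * U1t t x) t := fun t ht =>
    param_deriv (F := fun t x => U1 t x ^ 2) (F' := fun t x => 2 * U1 t x * U1t t x) ht
      (fun t ht x => by convert! (DU1t t ht x).fun_pow 2 using 1; simp) (cU1.pow 2) ((continuous_const.mul cU1).mul cU1t)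
  have Ce : ContinuousOn e (Set.Ici 0) := param_cont (F := fun t x => U t x ^ 2) (cU.pow 2)
  have Ci : ContinuousOn i (Set.Ici 0) := param_cont (F := fun t x => U1 t x ^ 2) (cU1.pow 2)
  have st : ∀ t : ℝ, 0 < t → _ := fun t ht => static hp (U := U t) (U1 := U1 t) (U2 := U2 t)
    (Ut := Ut t) (U1t := U1t t) (fun x => rpow_pos_of_pos (vpos t ht.le x) q)
    (DUx t ht) (DU1x t ht) (DUtx t ht) (sl cU2 t ht.le) (sl cU1t t ht.le) (eqn t ht)
    (by simp only [hU, p0]) (by simp only [hU1, p0, p1]) (by simp only [hU2, p0, p1, p2])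
  have i0 : ∀ t, 0 ≤ i t := fun t =>
    intervalIntegral.integral_nonneg (by linarith) fun x _ => sq_nonneg _
  have e0 : ∀ t, 0 ≤ t → 0 < e t := fun t ht => by
    refine intervalIntegral.intervalIntegral_pos_of_pos
      (((sl cU t ht).pow 2).intervalIntegrable _ _) ?_ (by linarith)
    intro x; have := rpow_pos_of_pos (vpos t ht x) q
    exact pow_pos this 2
  -- limits
  set E := 2 * π * (c ^ q) ^ 2 with hE
  have hE0 : 0 < E := by have := rpow_pos_of_pos hc q; positivity
  have Le : Tendsto e atTop (𝓝 E) := by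
    have : E = ∫ x in (-π)..π, (c ^ q) ^ 2 := by
      rw [intervalIntegral.integral_const, smul_eq_mul, hE]; ring
    rw [this]
    refine intervalIntegral.tendsto_integral_filter_of_dominated_convergence (fun _ => (M ^ q) ^ 2)
      ?_ ?_ intervalIntegrable_const ?_
    · filter_upwards [eventually_ge_atTop 0] with t ht
      exact ((sl cU t ht).pow 2).aestronglyMeasurable
    · filter_upwards [eventually_ge_atTop 0] with t ht
      filter_upwards with x _
      rw [norm_pow, Real.norm_of_nonneg (rpow_nonneg (vpos t ht x).le q)]
      have := vpos t ht x
      have := hM t ht x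
      change (v t x ^ q) ^ 2 ≤ _
      gcongr
    · filter_upwards with x _
      exact ((lim x).rpow_const (Or.inl hc.ne')).pow 2
  have Li : Tendsto i atTop (𝓝 0) := by
    have : (0 : ℝ) = ∫ x in (-π)..π, (q * c ^ (q - 1) * 0) ^ 2 := by simp
    rw [this]
    refine intervalIntegral.tendsto_integral_filter_of_dominated_convergence
      (fun _ => (q * m ^ (q - 1) * M) ^ 2) ?_ ?_ intervalIntegrable_const ?_
    · filter_upwards [eventually_ge_atTop 0] with t ht
      exact ((sl cU1 t ht).pow 2).aestronglyMeasurable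
    · filter_upwards [eventually_ge_atTop 0] with t ht
      filter_upwards with x _
      have h1 := vpos t ht x
      have h2 := hM1 t ht x
      have h3 : v t x ^ (q - 1) ≤ m ^ (q - 1) := by
        refine rpow_le_rpow_of_nonpos hm (hv t ht x) ?_
        have : q ≤ 1 := by rw [hq, div_le_one hp0]; linarith
        linarith
      have h4 := rpow_nonneg h1.le (q - 1)
      rw [norm_pow]
      simp only [hU1, norm_mul, Real.norm_eq_abs, abs_of_pos hq0, abs_of_nonneg h4]
      gcongr
    · filter_upwards with x _
      exact ((((lim x).rpow_const (Or.inl hc.ne')).const_mul q).mul (lim1 x)).pow 2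
  have hp2 : 0 < p - 2 := by linarith
  have eMono : MonotoneOn e (Set.Ici 0) := by
    refine monotoneOn_of_deriv_nonneg (convex_Ici 0) Ce ?_ ?_
    · intro t ht; rw [interior_Ici] at ht
      exact (De t ht).differentiableAt.differentiableWithinAt
    · intro t ht; rw [interior_Ici] at ht
      rw [(De t ht).deriv, (st t ht).1]
      have := i0 t
      simp only [hi] at this
      positivity
  have eE : ∀ t, 0 ≤ t → e t ≤ E := fun t ht => ge_of_tendsto Le (by
    filter_upwards [eventually_ge_atTop t] with s hs
    exact eMono ht (Set.mem_Ici.2 (ht.trans hs)) hs)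
  have anti : ∀ (G : ℝ → ℝ) (G' : ℝ → ℝ), ContinuousOn G (Set.Ici 0) →
      (∀ t, 0 < t → HasDerivAt G (G' t) t) → (∀ t, 0 < t → G' t ≤ 0) → Tendsto G atTop (𝓝 0) →
      ∀ t, 0 ≤ t → 0 ≤ G t := by
    intro G G' hc hd hn hl t ht
    have : AntitoneOn G (Set.Ici 0) := by
      refine antitoneOn_of_deriv_nonpos (convex_Ici 0) hc ?_ ?_
      · intro t ht; rw [interior_Ici] at ht
        exact (hd t ht).differentiableAt.differentiableWithinAt
      · intro t ht; rw [interior_Ici] at ht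
        rw [(hd t ht).deriv]; exact hn t ht
    refine le_of_tendsto hl ?_
    filter_upwards [eventually_ge_atTop t] with s hs
    exact this ht (Set.mem_Ici.2 (ht.trans hs)) hs
  set e' : ℝ → ℝ := fun t => ∫ x in (-π)..π, 2 * U t x * Ut t x with he'
  set i' : ℝ → ℝ := fun t => ∫ x in (-π)..π, 2 * U1 t x * U1t t x with hi'
  have st1 : ∀ t, 0 < t → e' t = 2 * (p - 2) * i t := fun t ht => (st t ht).1
  have st2 : ∀ t, 0 < t → i' t ≤ -2 * i t - 2 * (p - 1) / 3 * (i t ^ 2 / e t) :=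
    fun t ht => (st t ht).2
  have De' : ∀ t, 0 < t → HasDerivAt e (e' t) t := De
  have Di' : ∀ t, 0 < t → HasDerivAt i (i' t) t := Di
  clear_value e' i'
  have F0 := anti (fun t => i t + (e t - E) / (p - 2)) (fun t => i' t + e' t / (p - 2))
    (Ci.add ((Ce.sub continuousOn_const).div_const _))
    (fun t ht => (Di' t ht).add (((De' t ht).sub_const E).div_const _))
    (fun t ht => by
      rw [st1 t ht]
      have : 2 * (p - 2) * i t / (p - 2) = 2 * i t := by field_simp
      rw [this]
      have h1 := st2 t ht
      have h2 : 0 ≤ 2 * (p - 1) / 3 * (i t ^ 2 / e t) := by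
        have := e0 t ht.le
        have : 0 ≤ p - 1 := by linarith
        positivity
      linarith)
    (by simpa using Li.add ((Le.sub_const E).div_const (p - 2)))
  have G0 := anti (fun t => i t + (e t - E) / (p - 2) -
      (p - 1) / (6 * (p - 2) ^ 2) / E * (e t - E) ^ 2)
    (fun t => i' t + e' t / (p - 2) -
      (p - 1) / (6 * (p - 2) ^ 2) / E * (2 * (e t - E) * e' t))
    ((Ci.add ((Ce.sub continuousOn_const).div_const _)).sub
      (((Ce.sub continuousOn_const).pow 2).const_smul ((p - 1) / (6 * (p - 2) ^ 2) / E)))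
    (fun t ht => by
      have := ((Di' t ht).add (((De' t ht).sub_const E).div_const (p - 2))).sub
        ((((De' t ht).sub_const E).fun_pow 2).const_mul ((p - 1) / (6 * (p - 2) ^ 2) / E))
      convert! this using 1
      simp)
    (fun t ht => by
      rw [st1 t ht]
      have : 2 * (p - 2) * i t / (p - 2) = 2 * i t := by field_simp
      rw [this]
      have h1 := st2 t ht
      have h3 := e0 t ht.le
      have h4 := eE t ht.le
      have h5 := F0 t ht.le
      have h6 := i0 t
      have h7 : E - e t ≤ (p - 2) * i t := by
        have : (e t - E) / (p - 2) = - ((E - e t) / (p - 2)) := by ring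
        rw [this] at h5
        have : (E - e t) / (p - 2) ≤ i t := by linarith
        rw [div_le_iff₀ hp2] at this; linarith
      have h8 : (p - 1) / (6 * (p - 2) ^ 2) / E * (2 * (e t - E) * (2 * (p - 2) * i t)) =
        - (2 * (p - 1) / 3 * ((E - e t) / (p - 2) * i t / E)) := by field_simp; ring
      have h9 : (E - e t) / (p - 2) * i t / E ≤ i t ^ 2 / e t := by
        have : (E - e t) / (p - 2) ≤ i t := by rw [div_le_iff₀ hp2]; linarith
        calc (E - e t) / (p - 2) * i t / E ≤ i t * i t / E := by gcongr
          _ = i t ^ 2 / E := by ring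
          _ ≤ i t ^ 2 / e t := by gcongr
      have h10 : 0 ≤ 2 * (p - 1) / 3 := by linarith
      rw [h8]
      nlinarith [mul_le_mul_of_nonneg_left h9 h10])
    (by simpa using (Li.add ((Le.sub_const E).div_const (p - 2))).sub
          (((Le.sub_const E).pow 2).const_mul ((p - 1) / (6 * (p - 2) ^ 2) / E)))
  refine ⟨eE 0 le_rfl, ?_⟩
  have := G0 0 le_rfl
  have h1 : (e 0 - E) / (p - 2) = - ((E - e 0) / (p - 2)) := by ring
  have h2 : (e 0 - E) ^ 2 = (E - e 0) ^ 2 := by ring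
  simp only [h1, h2] at this
  change (E - e 0) / (p - 2) + (p - 1) / (6 * (p - 2) ^ 2) / E * (E - e 0) ^ 2 ≤ i 0
  linarith

noncomputable def trigH (S : Finset ℤ) (A B : ℤ → ℝ) (t x : ℝ) : ℝ :=
  ∑ k ∈ S, exp (-(k : ℝ) ^ 2 * t) * (A k * cos (k * x) + B k * sin (k * x))

lemma trigH_cont (S : Finset ℤ) (A B : ℤ → ℝ) :
    Continuous fun z : ℝ × ℝ => trigH S A B z.1 z.2 := by
  unfold trigH; fun_prop

lemma trigH_dx (S : Finset ℤ) (A B : ℤ → ℝ) (t x : ℝ) :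
    HasDerivAt (trigH S A B t) (trigH S (fun k => k * B k) (fun k => -(k * A k)) t x) x := by
  unfold trigH
  refine HasDerivAt.fun_sum fun k _ => ?_
  have h1 : HasDerivAt (fun x : ℝ => (k : ℝ) * x) (k : ℝ) x := by
    simpa using (hasDerivAt_id x).const_mul (k : ℝ)
  have := (((h1.cos).const_mul (A k)).add ((h1.sin).const_mul (B k))).const_mul
    (exp (-(k : ℝ) ^ 2 * t))
  convert! this using 1
  ring

lemma trigH_dt (S : Finset ℤ) (A B : ℤ → ℝ) (t x : ℝ) :
    HasDerivAt (fun t => trigH S A B t x)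
      (trigH S (fun k => k * -(k * A k)) (fun k => -(k * (k * B k))) t x) t := by
  unfold trigH
  refine HasDerivAt.fun_sum fun k _ => ?_
  have h1 : HasDerivAt (fun t : ℝ => -(k : ℝ) ^ 2 * t) (-(k : ℝ) ^ 2) t := by
    simpa using (hasDerivAt_id t).const_mul (-(k : ℝ) ^ 2)
  have := h1.exp.mul_const (A k * cos (k * x) + B k * sin (k * x))
  convert! this using 1
  ring

lemma trigH_per (S : Finset ℤ) (A B : ℤ → ℝ) (t x : ℝ) :
    trigH S A B t (x + 2 * π) = trigH S A B t x := by
  unfold trigH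
  refine Finset.sum_congr rfl fun k _ => ?_
  rw [show (k : ℝ) * (x + 2 * π) = k * x + k * (2 * π) by ring, cos_add_int_mul_two_pi,
    sin_add_int_mul_two_pi]

lemma trigH_bd (S : Finset ℤ) (A B : ℤ → ℝ) (t : ℝ) (ht : 0 ≤ t) (x : ℝ) :
    |trigH S A B t x| ≤ ∑ k ∈ S, (|A k| + |B k|) := by
  unfold trigH
  refine (Finset.abs_sum_le_sum_abs _ _).trans (Finset.sum_le_sum fun k _ => ?_)
  rw [abs_mul, abs_of_pos (exp_pos _)]
  have h1 : exp (-(k : ℝ) ^ 2 * t) ≤ 1 := by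
    rw [exp_le_one_iff]; nlinarith [mul_nonneg (sq_nonneg (k : ℝ)) ht]
  have h2 : |A k * cos (k * x) + B k * sin (k * x)| ≤ |A k| + |B k| := by
    refine (abs_add_le _ _).trans ?_
    rw [abs_mul, abs_mul]
    have := abs_cos_le_one (k * x)
    have := abs_sin_le_one (k * x)
    gcongr
    · exact mul_le_of_le_one_right (abs_nonneg _) (abs_cos_le_one _)
    · exact mul_le_of_le_one_right (abs_nonneg _) (abs_sin_le_one _)
  calc _ ≤ 1 * (|A k| + |B k|) := by gcongr
    _ = _ := one_mul _

lemma trigH_lim (S : Finset ℤ) (A B : ℤ → ℝ) (x : ℝ) :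
    Tendsto (fun t => trigH S A B t x) atTop (𝓝 (∑ k ∈ S, if k = 0 then A k else 0)) := by
  unfold trigH
  refine tendsto_finsetSum _ fun k _ => ?_
  by_cases hk : k = 0
  · subst hk; simp
  · simp only [hk, if_false]
    have h : Tendsto (fun t : ℝ => exp (-(k : ℝ) ^ 2 * t)) atTop (𝓝 0) := by
      refine tendsto_exp_atBot.comp ?_
      refine tendsto_id.const_mul_atTop_of_neg ?_
      have : (k : ℝ) ≠ 0 := by exact_mod_cast hk
      have : 0 < (k : ℝ) ^ 2 := by positivity
      linarith
    simpa using h.mul_const (A k * cos (k * x) + B k * sin (k * x))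

lemma trigH_int (S : Finset ℤ) (A B : ℤ → ℝ) :
    ∫ x in (-π)..π, trigH S A B 0 x = 2 * π * ∑ k ∈ S, if k = 0 then A k else 0 := by
  unfold trigH
  rw [intervalIntegral.integral_finsetSum
    (fun k _ => Continuous.intervalIntegrable (by fun_prop) _ _), Finset.mul_sum]
  refine Finset.sum_congr rfl fun k _ => ?_
  by_cases hk : k = 0
  · subst hk; simp; left; ring
  · simp only [hk, if_false, mul_zero]
    have hk' : (k : ℝ) ≠ 0 := by exact_mod_cast hk
    refine int_deriv_zero (F := fun x => A k / k * sin (k * x) - B k / k * cos (k * x))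
      (fun x => ?_) (by fun_prop) ?_
    · have h1 : HasDerivAt (fun x : ℝ => (k : ℝ) * x) (k : ℝ) x := by
        simpa using (hasDerivAt_id x).const_mul (k : ℝ)
      have := ((h1.sin).const_mul (A k / k)).sub ((h1.cos).const_mul (B k / k))
      convert! this using 1
      simp; field_simp
    · have := sin_add_int_mul_two_pi (k * (-π)) k
      have h2 := cos_add_int_mul_two_pi (k * (-π)) k
      rw [show (k : ℝ) * (-π) + k * (2 * π) = k * π by ring] at this h2
      simp only [this, h2]

lemma gauss_cos (k t : ℝ) (ht : 0 ≤ t) :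
    ∫ y, cos (k * y) ∂(ProbabilityTheory.gaussianReal 0 (2 * t).toNNReal) = exp (-k ^ 2 * t) ∧
    ∫ y, sin (k * y) ∂(ProbabilityTheory.gaussianReal 0 (2 * t).toNNReal) = 0 := by
  have h := ProbabilityTheory.charFun_gaussianReal (μ := 0) (v := (2 * t).toNNReal) k
  rw [charFun_apply_real] at h
  have hint : Integrable (fun y : ℝ => Complex.exp (k * y * Complex.I))
      (ProbabilityTheory.gaussianReal 0 (2 * t).toNNReal) := by
    refine Integrable.of_bound (C := 1) (by fun_prop) ?_
    filter_upwards with y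
    rw [← Complex.ofReal_mul, Complex.norm_exp_ofReal_mul_I]
  have e : Complex.exp (k * (0 : ℝ) * Complex.I - (2 * t).toNNReal * k ^ 2 / 2)
      = ((exp (-k ^ 2 * t) : ℝ) : ℂ) := by
    have : (((2 * t).toNNReal : ℝ) : ℂ) = ((2 * t : ℝ) : ℂ) := by
      rw [Real.coe_toNNReal _ (by positivity)]
    rw [Complex.ofReal_exp]
    congr 1
    simp only [this]
    push_cast
    ring
  rw [e] at h
  constructor
  · have := congrArg Complex.re h
    rw [Complex.ofReal_re, ← RCLike.re_eq_complex_re, ← integral_re hint] at this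
    rw [← this]
    congr 1; ext y
    simp only [RCLike.re_eq_complex_re]
    rw [← Complex.ofReal_mul, Complex.exp_ofReal_mul_I_re]
  · have := congrArg Complex.im h
    rw [Complex.ofReal_im, ← RCLike.im_eq_complex_im, ← integral_im hint] at this
    refine Eq.trans (integral_congr_ae (ae_of_all _ fun y => ?_)) this
    simp only [RCLike.im_eq_complex_im]
    rw [← Complex.ofReal_mul, Complex.exp_ofReal_mul_I_im]

lemma trigH_gauss (S : Finset ℤ) (A B : ℤ → ℝ) (t : ℝ) (ht : 0 ≤ t) (x : ℝ) :
    ∫ y, trigH S A B 0 (x + y) ∂(ProbabilityTheory.gaussianReal 0 (2 * t).toNNReal)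
      = trigH S A B t x := by
  have ic : ∀ k : ℝ, Integrable (fun y : ℝ => cos (k * y))
      (ProbabilityTheory.gaussianReal 0 (2 * t).toNNReal) := fun k =>
    Integrable.of_bound (C := 1) (by fun_prop) (ae_of_all _ fun y => abs_cos_le_one _)
  have is : ∀ k : ℝ, Integrable (fun y : ℝ => sin (k * y))
      (ProbabilityTheory.gaussianReal 0 (2 * t).toNNReal) := fun k =>
    Integrable.of_bound (C := 1) (by fun_prop) (ae_of_all _ fun y => abs_sin_le_one _)
  unfold trigH
  have e : ∀ y : ℝ, ∀ k : ℤ, exp (-(k : ℝ) ^ 2 * 0) * (A k * cos (k * (x + y)) + B k * sin (k * (x + y)))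
      = (A k * cos (k * x) + B k * sin (k * x)) * cos (k * y) +
        (B k * cos (k * x) - A k * sin (k * x)) * sin (k * y) := by
    intro y k
    rw [show (k : ℝ) * (x + y) = k * x + k * y by ring, cos_add, sin_add]; simp; ring
  simp_rw [e]
  rw [integral_finsetSum _ (fun (k : ℤ) _ => by exact ((ic k).const_mul _).add ((is k).const_mul _))]
  refine Finset.sum_congr rfl fun k _ => ?_
  rw [integral_add ((ic k).const_mul _) ((is k).const_mul _), integral_const_mul,
    integral_const_mul, (gauss_cos k t ht).1, (gauss_cos k t ht).2]
  ring

lemma trigH_ge (S : Finset ℤ) (A B : ℤ → ℝ) (m : ℝ) (h : ∀ x, m ≤ trigH S A B 0 x)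
    (t : ℝ) (ht : 0 ≤ t) (x : ℝ) : m ≤ trigH S A B t x := by
  rw [← trigH_gauss S A B t ht x]
  have : m = ∫ _, m ∂(ProbabilityTheory.gaussianReal 0 (2 * t).toNNReal) := by simp
  rw [this]
  refine integral_mono (integrable_const _) ?_ (fun y => by simpa using h (x + y))
  refine Integrable.of_bound (C := ∑ k ∈ S, (|A k| + |B k|)) ?_
    (ae_of_all _ fun y => trigH_bd S A B 0 le_rfl _)
  have := (trigH_cont S A B).comp (by fun_prop : Continuous fun y : ℝ => ((0 : ℝ), x + y))
  exact Continuous.aestronglyMeasurable this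

lemma trig_ineq {p : ℝ} (hp : 2 < p) (S : Finset ℤ) (A B : ℤ → ℝ) (m : ℝ) (hm : 0 < m)
    (h : ∀ x, m ≤ trigH S A B 0 x) {v v1 : ℝ → ℝ} (hv : v = trigH S A B 0)
    (hv1 : v1 = trigH S (fun k => k * B k) (fun k => -(k * A k)) 0) {E e i : ℝ}
    (hE : E = 2 * π * ((1 / (2 * π) * ∫ x in (-π)..π, v x) ^ (1 / p)) ^ 2)
    (he : e = ∫ x in (-π)..π, (v x ^ (1 / p)) ^ 2)
    (hi : i = ∫ x in (-π)..π, (1 / p * v x ^ (1 / p - 1) * v1 x) ^ 2) :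
    e ≤ E ∧ (E - e) / (p - 2) + (p - 1) / (6 * (p - 2) ^ 2) / E * (E - e) ^ 2 ≤ i := by
  have hpi := pi_pos
  set c := ∑ k ∈ S, if k = 0 then A k else 0 with hc
  have hEc : E = 2 * π * (c ^ (1 / p)) ^ 2 := by
    rw [hE, hv, trigH_int, ← hc]
    rw [show 1 / (2 * π) * (2 * π * c) = c by field_simp]
  have pp : ∀ A B t, trigH S A B t π = trigH S A B t (-π) := fun A B t => by
    rw [← trigH_per S A B t (-π)]; ring_nf
  rw [hEc, he, hi, hv, hv1]
  refine flow hp (v := trigH S A B) (v1 := trigH S (fun k => k * B k) (fun k => -(k * A k)))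
    (v2 := trigH S (fun k => k * -(k * A k)) (fun k => -(k * (k * B k))))
    (v3 := trigH S (fun k => k * -(k * (k * B k))) (fun k => -(k * (k * -(k * A k)))))
    (M := max (∑ k ∈ S, (|A k| + |B k|)) (∑ k ∈ S, (|k * B k| + |-(k * A k)|)))
    hm (trigH_ge S A B m h) (fun t ht x => (le_abs_self _).trans
      ((trigH_bd S A B t ht x).trans (le_max_left _ _)))
    (fun t ht x => (trigH_bd S _ _ t ht x).trans (le_max_right _ _))
    (trigH_cont _ _ _) (trigH_cont _ _ _) (trigH_cont _ _ _) (trigH_cont _ _ _)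
    (trigH_dx _ _ _) (trigH_dx _ _ _) (trigH_dx _ _ _) (trigH_dt _ _ _) (trigH_dt _ _ _)
    (pp _ _) (pp _ _) (pp _ _) (trigH_lim S A B) ?_
  intro x
  have := trigH_lim S (fun k => k * B k) (fun k => -(k * A k)) x
  convert! this using 2
  symm
  refine Finset.sum_eq_zero fun k _ => ?_
  by_cases hk : k = 0
  · subst hk; simp
  · simp [hk]

lemma l2_approx {f : ℝ → ℝ} (hf : MemLp f 2 (volume.restrict (Set.Ioc (-π) π))) {δ : ℝ} (hδ : 0 < δ) :
    ∃ (S : Finset ℤ) (a b : ℤ → ℝ), ∫ x in (-π)..π, (trigH S a b 0 x - f x) ^ 2 ≤ δ := by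
  have hpi := pi_pos
  have : Fact (0 < 2 * π) := ⟨by positivity⟩
  have e1 : -π + 2 * π = π := by ring
  have hf' : MemLp (fun x => (f x : ℂ)) 2 (volume.restrict (Set.Ioc (-π) (-π + 2 * π))) := by
    rw [e1]; exact hf.ofReal
  have h := hf'.memLp_liftIoc.haarAddCircle
  have hs := hasSum_fourier_series_L2 h.toLp
  set c : ℤ → ℂ := fun k => fourierCoeff (h.toLp) k with hc
  have hδ' : 0 < sqrt (δ / (2 * π)) := by positivity
  obtain ⟨S, hS⟩ := (Metric.tendsto_nhds.1 hs _ hδ').exists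
  rw [dist_eq_norm] at hS
  set G := (∑ k ∈ S, c k • fourierLp (T := 2 * π) 2 k) - h.toLp with hG
  have n2 : ‖G‖ ^ 2 = ∫ t : AddCircle (2 * π), ‖G t‖ ^ 2 ∂AddCircle.haarAddCircle := by
    have H₃ := congr_arg RCLike.re (@L2.inner_def (AddCircle (2 * π)) ℂ ℂ _ _ _ _ _ G G)
    rw [← integral_re] at H₃
    · simpa only [← norm_sq_eq_re_inner] using H₃
    · exact L2.integrable_inner G G
  have Gae : (fun t => ‖G t‖ ^ 2) =ᵐ[AddCircle.haarAddCircle] fun t => ‖(∑ k ∈ S, c k * fourier (T := 2 * π) k t)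
      - AddCircle.liftIoc (2 * π) (-π) (fun x => (f x : ℂ)) t‖ ^ 2 := by
    have h1 := Lp.coeFn_sub (∑ k ∈ S, c k • fourierLp (T := 2 * π) 2 k) h.toLp
    have h2 := Lp.coeFn_finsetSum S (fun k => c k • fourierLp (T := 2 * π) 2 k)
    have h3 : ∀ᵐ t ∂(AddCircle.haarAddCircle (T := 2 * π)), ∀ k : ℤ,
        (c k • fourierLp (T := 2 * π) 2 k : Lp ℂ 2 AddCircle.haarAddCircle) t = c k * fourier (T := 2 * π) k t := by
      rw [ae_all_iff]; intro k
      filter_upwards [Lp.coeFn_smul (c k) (fourierLp (T := 2 * π) 2 k), coeFn_fourierLp (T := 2 * π) 2 k] with t h4 h5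
      rw [h4, Pi.smul_apply, h5, smul_eq_mul]
    filter_upwards [h1, h2, h3, h.coeFn_toLp] with t h1 h2 h3 h4
    rw [hG, h1, Pi.sub_apply, h4, h2, Finset.sum_apply]
    simp_rw [h3]
  rw [integral_congr_ae Gae, AddCircle.integral_haarAddCircle,
    ← AddCircle.intervalIntegral_preimage (2 * π) (-π)] at n2
  refine ⟨S, fun k => (c k).re, fun k => -(c k).im, ?_⟩
  have key : ∀ x : ℝ, trigH S (fun k => (c k).re) (fun k => -(c k).im) 0 x =
      (∑ k ∈ S, c k * fourier (T := 2 * π) k (x : AddCircle (2 * π))).re := by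
    intro x
    unfold trigH
    rw [Complex.re_sum]
    refine Finset.sum_congr rfl fun k _ => ?_
    rw [fourier_coe_apply]
    have : (2 * π * Complex.I * k * x / ((2 * π : ℝ) : ℂ) : ℂ) = ((k * x : ℝ) : ℂ) * Complex.I := by
      push_cast; field_simp
    rw [this, Complex.mul_re, Complex.exp_ofReal_mul_I_re, Complex.exp_ofReal_mul_I_im]
    simp; ring
  set P : ℝ → ℂ := fun x => ∑ k ∈ S, c k * fourier (T := 2 * π) k (x : AddCircle (2 * π)) with hP
  have Pc : Continuous P := by
    refine continuous_finsetSum _ fun k _ => continuous_const.mul ?_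
    exact (map_continuous (fourier (T := 2 * π) k)).comp (AddCircle.continuous_mk' (2 * π))
  have PL : MemLp P 2 (volume.restrict (Set.Ioc (-π) π)) := by
    refine (memLp_two_iff_integrable_sq_norm Pc.aestronglyMeasurable).2 ?_
    exact (Continuous.intervalIntegrable (by fun_prop) (-π) π).1
  have FL : MemLp (fun x => P x - (f x : ℂ)) 2 (volume.restrict (Set.Ioc (-π) π)) := PL.sub hf.ofReal
  have FI : IntervalIntegrable (fun x => ‖P x - (f x : ℂ)‖ ^ 2) volume (-π) π :=
    (intervalIntegrable_iff_integrableOn_Ioc_of_le (by linarith)).2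
      ((memLp_two_iff_integrable_sq_norm FL.1).1 FL)
  have gI : IntervalIntegrable (fun x => (trigH S (fun k => (c k).re) (fun k => -(c k).im) 0 x - f x) ^ 2) volume (-π) π := by
    refine FI.mono_fun ?_ ?_
    · refine (AEStronglyMeasurable.sub ?_ ?_).pow 2
      · exact ((trigH_cont S _ _).comp (Continuous.prodMk continuous_const continuous_id)).aestronglyMeasurable
      · rw [Set.uIoc_of_le (by linarith)]; exact hf.1
    · refine ae_of_all _ fun x => ?_
      simp only [norm_pow, norm_norm]
      gcongr
      rw [key]
      have := Complex.abs_re_le_norm (P x - (f x : ℂ))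
      rw [Complex.sub_re, Complex.ofReal_re] at this
      exact this
  have m1 : ∫ x in (-π)..π, (trigH S (fun k => (c k).re) (fun k => -(c k).im) 0 x - f x) ^ 2
      ≤ ∫ x in (-π)..π, ‖P x - (f x : ℂ)‖ ^ 2 := by
    refine intervalIntegral.integral_mono_on (by linarith) gI FI fun x _ => ?_
    rw [key, ← sq_abs]
    gcongr
    have := Complex.abs_re_le_norm (P x - (f x : ℂ))
    rw [Complex.sub_re, Complex.ofReal_re] at this
    exact this
  have m2 : ∫ x in (-π)..(-π + 2 * π), ‖(∑ k ∈ S, c k * fourier (T := 2 * π) k (x : AddCircle (2 * π)))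
      - AddCircle.liftIoc (2 * π) (-π) (fun x => (f x : ℂ)) (x : AddCircle (2 * π))‖ ^ 2 = ∫ x in (-π)..π, ‖P x - (f x : ℂ)‖ ^ 2 := by
    rw [e1]
    apply intervalIntegral.integral_congr_ae
    refine .of_forall fun x hx => ?_
    rw [Set.uIoc_of_le (by linarith)] at hx
    rw [AddCircle.liftIoc_coe_apply (by rw [e1]; exact hx)]
  rw [m2, smul_eq_mul] at n2
  refine m1.trans ?_
  have : ‖G‖ ^ 2 ≤ δ / (2 * π) := by
    rw [← Real.sq_sqrt (show 0 ≤ δ / (2 * π) by positivity)]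
    gcongr
  rw [n2, inv_mul_eq_div] at this
  exact (div_le_div_iff_of_pos_right (by positivity)).1 this

lemma trigH_c0 (S : Finset ℤ) (A B : ℤ → ℝ) : Continuous (trigH S A B 0) :=
  (trigH_cont S A B).comp (Continuous.prodMk continuous_const continuous_id)

lemma sq_int_to_int {f : ℝ → ℝ} (hm : Measurable f) {x y : ℝ}
    (h : IntervalIntegrable (fun s => (f s) ^ 2) volume x y) : IntervalIntegrable f volume x y := by
  have h1 : IntervalIntegrable (fun s => 1 + (f s) ^ 2) volume x y :=
    intervalIntegrable_const.add h
  refine h1.mono_fun hm.aestronglyMeasurable (ae_of_all _ fun s => ?_)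
  beta_reduce
  rw [norm_eq_abs, norm_eq_abs, abs_of_nonneg (by positivity : 0 ≤ 1 + f s ^ 2)]
  nlinarith [sq_abs (f s), sq_nonneg (|f s| - 1), abs_nonneg (f s)]

lemma sub_sq_int {f g : ℝ → ℝ} (hm : Measurable f) (hg : Measurable g) {x y : ℝ}
    (h : IntervalIntegrable (fun s => (f s) ^ 2) volume x y)
    (h' : IntervalIntegrable (fun s => (g s) ^ 2) volume x y) :
    IntervalIntegrable (fun s => (g s - f s) ^ 2) volume x y := by
  refine ((h.const_mul 2).add (h'.const_mul 2)).mono_fun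
    ((hg.sub hm).pow_const 2).aestronglyMeasurable (ae_of_all _ fun s => ?_)
  beta_reduce
  rw [norm_eq_abs, norm_eq_abs, abs_of_nonneg (by positivity), abs_of_nonneg (by positivity)]
  nlinarith [sq_nonneg (f s + g s)]

lemma approx {v : ℝ → ℝ} (hd : Differentiable ℝ v) (hper : Function.Periodic v (2 * π))
    (hL : IntervalIntegrable (fun s => (deriv v s) ^ 2) volume (-π) π) {ε : ℝ} (hε : 0 < ε) :
    ∃ (S : Finset ℤ) (A B : ℤ → ℝ), (∀ x, |trigH S A B 0 x - v x| ≤ ε) ∧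
      ∫ x in (-π)..π, (trigH S (fun k => k * B k) (fun k => -(k * A k)) 0 x - deriv v x) ^ 2 ≤ ε := by
  have hpi := pi_pos
  have hm : Measurable (deriv v) := measurable_deriv v
  have hf : MemLp (deriv v) 2 (volume.restrict (Set.Ioc (-π) π)) := by
    refine (memLp_two_iff_integrable_sq hm.aestronglyMeasurable).2 hL.1
  have fI := sq_int_to_int hm hL
  have f0 : ∫ x in (-π)..π, deriv v x = 0 := by
    rw [intervalIntegral.integral_deriv_eq_sub (fun x _ => hd x) fI]
    have := hper (-π)
    rw [show -π + 2 * π = π by ring] at this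
    linarith
  set δ := min ε (ε ^ 2 / (2 * π)) with hδ
  have hδ0 : 0 < δ := by positivity
  obtain ⟨S, a, b, h⟩ := l2_approx hf hδ0
  set S0 := S.erase 0 with hS0
  set g0 := trigH S0 a b 0 with hg0
  have g0c : Continuous g0 := trigH_c0 _ _ _
  obtain ⟨c0, hc0⟩ : ∃ c0 : ℝ, ∀ x, trigH S a b 0 x = g0 x + c0 := by
    by_cases h0 : (0 : ℤ) ∈ S
    · refine ⟨a 0, fun x => ?_⟩
      rw [hg0, hS0]; unfold trigH
      rw [← Finset.sum_erase_add S _ h0]; simp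
    · refine ⟨0, fun x => ?_⟩
      rw [hg0, hS0, Finset.erase_eq_of_notMem h0, add_zero]
  have g0i : ∫ x in (-π)..π, g0 x = 0 := by
    rw [hg0, trigH_int]
    rw [Finset.sum_eq_zero, mul_zero]
    intro k hk
    rw [if_neg (Finset.ne_of_mem_erase hk)]
  have dI : IntervalIntegrable (fun x => g0 x - deriv v x) volume (-π) π :=
    (g0c.intervalIntegrable _ _).sub fI
  have dI2 : IntervalIntegrable (fun x => (g0 x - deriv v x) ^ 2) volume (-π) π :=
    sub_sq_int hm g0c.measurable hL (Continuous.intervalIntegrable (by fun_prop) _ _)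
  have d0 : ∫ x in (-π)..π, (g0 x - deriv v x) = 0 := by
    rw [intervalIntegral.integral_sub (g0c.intervalIntegrable _ _) fI, g0i, f0, sub_zero]
  have hd2 : ∫ x in (-π)..π, (g0 x - deriv v x) ^ 2 ≤ δ := by
    refine le_trans ?_ h
    have : ∀ x, (trigH S a b 0 x - deriv v x) ^ 2 = (g0 x - deriv v x) ^ 2 + ((2 * c0) * (g0 x - deriv v x) + c0 ^ 2) := by
      intro x; rw [hc0]; ring
    simp_rw [this]
    rw [intervalIntegral.integral_add dI2 ((dI.const_mul _).add intervalIntegrable_const),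
      intervalIntegral.integral_add (dI.const_mul _) intervalIntegrable_const,
      intervalIntegral.integral_const_mul, d0, intervalIntegral.integral_const, smul_eq_mul]
    nlinarith [mul_nonneg hpi.le (sq_nonneg c0)]
  set A0 : ℤ → ℝ := fun k => -(b k) / k with hA0
  set B : ℤ → ℝ := fun k => if k = 0 then 0 else a k / k with hB
  set C := v (-π) - trigH S0 A0 B 0 (-π) with hC
  set A : ℤ → ℝ := fun k => if k = 0 then C else A0 k with hA
  have n0 : (0 : ℤ) ∉ S0 := Finset.notMem_erase _ _
  have T : ∀ x, trigH (insert 0 S0) A B 0 x = C + trigH S0 A0 B 0 x := by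
    intro x
    unfold trigH
    rw [Finset.sum_insert n0]
    congr 1
    · simp [hA]
    · refine Finset.sum_congr rfl fun k hk => ?_
      rw [hA]; simp only [if_neg (Finset.ne_of_mem_erase hk)]
  have T' : trigH (insert 0 S0) (fun k => k * B k) (fun k => -(k * A k)) 0 = g0 := by
    funext x
    rw [hg0]
    unfold trigH
    rw [Finset.sum_insert n0]
    simp only [Int.cast_zero, zero_mul, neg_zero, add_zero, mul_zero, zero_add]
    refine Finset.sum_congr rfl fun k hk => ?_
    have hk0 := Finset.ne_of_mem_erase hk
    have hk1 : (k : ℝ) ≠ 0 := by exact_mod_cast hk0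
    rw [hA, hB, hA0]; simp only [if_neg hk0]
    rw [mul_div_cancel₀ _ hk1, mul_div_cancel₀ _ hk1, neg_neg]
  refine ⟨insert 0 S0, A, B, ?_, ?_⟩
  swap
  · rw [T']; exact hd2.trans (min_le_left _ _)
  have habs : ∫ x in (-π)..π, |g0 x - deriv v x| ≤ ε := by
    have : ∫ x in (-π)..π, |g0 x - deriv v x| ≤ ∫ x in (-π)..π, (ε / (4 * π) + (π / ε) * (g0 x - deriv v x) ^ 2) := by
      refine intervalIntegral.integral_mono_on (by linarith) dI.abs (intervalIntegrable_const.add (dI2.const_mul _)) fun x _ => ?_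
      set y := |g0 x - deriv v x| with hy
      rw [← sq_abs, ← hy]
      have : ε / (4 * π) + π / ε * y ^ 2 - y = (π / ε) * (y - ε / (2 * π)) ^ 2 := by field_simp; ring
      have h2 : 0 ≤ (π / ε) * (y - ε / (2 * π)) ^ 2 := by positivity
      linarith
    rw [intervalIntegral.integral_add intervalIntegrable_const (dI2.const_mul _), intervalIntegral.integral_const_mul,
      intervalIntegral.integral_const, smul_eq_mul] at this
    have h3 : π / ε * (∫ x in (-π)..π, (g0 x - deriv v x) ^ 2) ≤ π / ε * (ε ^ 2 / (2 * π)) := by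
      gcongr; exact hd2.trans (min_le_right _ _)
    have h4 : π / ε * (ε ^ 2 / (2 * π)) = ε / 2 := by field_simp
    have h5 : (π - -π) * (ε / (4 * π)) = ε / 2 := by field_simp; ring
    linarith
  have main : ∀ x ∈ Set.Ioc (-π) π, |trigH (insert 0 S0) A B 0 x - v x| ≤ ε := by
    intro x hx
    have hsub : Set.uIcc (-π) x ⊆ Set.uIcc (-π) π := by
      rw [Set.uIcc_of_le hx.1.le, Set.uIcc_of_le (by linarith)]
      exact Set.Icc_subset_Icc le_rfl hx.2
    have F := intervalIntegral.integral_eq_sub_of_hasDerivAt (a := -π) (b := x)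
      (f := fun x => trigH (insert 0 S0) A B 0 x - v x) (f' := fun x => g0 x - deriv v x)
      (fun y _ => by
        have := (trigH_dx (insert 0 S0) A B 0 y).sub (hd y).hasDerivAt
        rw [T'] at this; exact this) (dI.mono_set hsub)
    have z : trigH (insert 0 S0) A B 0 (-π) - v (-π) = 0 := by rw [T, hC]; ring
    simp only [z, sub_zero] at F
    rw [← F]
    refine (intervalIntegral.abs_integral_le_integral_abs hx.1.le).trans (le_trans ?_ habs)
    exact intervalIntegral.integral_mono_interval le_rfl hx.1.le hx.2 (ae_of_all _ fun y => abs_nonneg _) dI.abs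
  intro x
  have hp2 : Function.Periodic (fun x => |trigH (insert 0 S0) A B 0 x - v x|) (2 * π) := by
    intro y; simp only [trigH_per, hper y]
  obtain ⟨y, hy, e⟩ := hp2.exists_mem_Ioc (by positivity) x (-π)
  rw [show -π + 2 * π = π by ring] at hy
  have := main y hy
  rw [e]; exact this

lemma per_bounds {v : ℝ → ℝ} (hc : Continuous v) (hper : Function.Periodic v (2 * π))
    (hpos : ∀ s, 0 < v s) : ∃ m M : ℝ, 0 < m ∧ ∀ s, m ≤ v s ∧ v s ≤ M := by
  have hpi := pi_pos
  have ne : (Set.Icc (-π) π).Nonempty := ⟨0, by constructor <;> linarith⟩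
  obtain ⟨x, -, hx⟩ := isCompact_Icc.exists_isMinOn ne hc.continuousOn
  obtain ⟨y, -, hy⟩ := isCompact_Icc.exists_isMaxOn ne hc.continuousOn
  refine ⟨v x, v y, hpos x, fun s => ?_⟩
  obtain ⟨z, hz, e⟩ := hper.exists_mem_Ioc (by positivity) s (-π)
  rw [show -π + 2 * π = π by ring] at hz
  rw [e]
  exact ⟨hx ⟨hz.1.le, hz.2⟩, hy ⟨hz.1.le, hz.2⟩⟩

lemma improved {p : ℝ} (hp : 2 < p) {u : ℝ → ℝ} (hper : Function.Periodic u (2 * π))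
    (hpos : ∀ s, 0 < u s) (hdiff : Differentiable ℝ u)
    (hL2 : IntervalIntegrable (fun s => (deriv u s) ^ 2) volume (-π) π)
    {E e i : ℝ} (hE : E = 2 * π * ((1 / (2 * π) * ∫ x in (-π)..π, u x ^ p) ^ (1 / p)) ^ 2)
    (he : e = ∫ x in (-π)..π, (u x) ^ 2) (hi : i = ∫ x in (-π)..π, (deriv u x) ^ 2) :
    0 < E ∧ e ≤ E ∧ (E - e) / (p - 2) + (p - 1) / (6 * (p - 2) ^ 2) / E * (E - e) ^ 2 ≤ i := by
  have hpi := pi_pos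
  have hp0 : 0 < p := by linarith
  have hpi2 : -π ≤ π := by linarith
  set v : ℝ → ℝ := fun x => u x ^ p with hv
  have vpos : ∀ s, 0 < v s := fun s => rpow_pos_of_pos (hpos s) p
  have vd : ∀ s, HasDerivAt v (deriv u s * p * u s ^ (p - 1)) s := fun s =>
    (hdiff s).hasDerivAt.rpow_const (Or.inl (hpos s).ne')
  have vdiff : Differentiable ℝ v := fun s => (vd s).differentiableAt
  have vc := vdiff.continuous
  have uc := hdiff.continuous
  have vper : Function.Periodic v (2 * π) := fun s => by simp only [hv, hper s]
  have vder : ∀ s, deriv v s = deriv u s * p * u s ^ (p - 1) := fun s => (vd s).deriv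
  have vL2 : IntervalIntegrable (fun s => (deriv v s) ^ 2) volume (-π) π := by
    have : (fun s => (deriv v s) ^ 2) = fun s => (p * u s ^ (p - 1)) ^ 2 * (deriv u s) ^ 2 := by
      funext s; rw [vder]; ring
    rw [this]
    refine hL2.continuousOn_mul (Continuous.continuousOn ?_)
    exact (continuous_const.mul (uc.rpow_const fun s => Or.inl (hpos s).ne')).pow 2
  obtain ⟨m, M, hm, hmM⟩ := per_bounds vc vper vpos
  have hM : 0 < M := hm.trans_le ((hmM 0).1.trans (hmM 0).2)
  have hε : ∀ n : ℕ, 0 < m / 2 * (1 / ((n : ℝ) + 1)) := fun n => by positivity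
  have hε1 : ∀ n : ℕ, m / 2 * (1 / ((n : ℝ) + 1)) ≤ m / 2 := fun n => by
    have : 1 / ((n : ℝ) + 1) ≤ 1 := by
      rw [div_le_one (by positivity)]; linarith [(n.cast_nonneg : (0 : ℝ) ≤ n)]
    nlinarith
  have hε0 : Tendsto (fun n : ℕ => m / 2 * (1 / ((n : ℝ) + 1))) atTop (𝓝 0) := by
    simpa using tendsto_one_div_add_atTop_nhds_zero_nat.const_mul (m / 2)
  choose S A B hsup hint using fun n => approx vdiff vper vL2 (hε n)
  set V : ℕ → ℝ → ℝ := fun n => trigH (S n) (A n) (B n) 0 with hV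
  set V1 : ℕ → ℝ → ℝ := fun n => trigH (S n) (fun k => k * B n k) (fun k => -(k * A n k)) 0 with hV1
  have Vc : ∀ n, Continuous (V n) := fun n => trigH_c0 _ _ _
  have V1c : ∀ n, Continuous (V1 n) := fun n => trigH_c0 _ _ _
  have Vlo : ∀ n x, m / 2 ≤ V n x := fun n x => by
    have h1 := abs_le.1 (hsup n x); linarith [hε1 n, (hmM x).1]
  have Vpos : ∀ n x, 0 < V n x := fun n x => by linarith [Vlo n x]
  have Vhi : ∀ n x, V n x ≤ M + m / 2 := fun n x => by
    have h1 := abs_le.1 (hsup n x); linarith [hε1 n, (hmM x).2]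
  have Vlim : ∀ x, Tendsto (fun n => V n x) atTop (𝓝 (v x)) := fun x => by
    rw [tendsto_iff_norm_sub_tendsto_zero]
    exact squeeze_zero (fun n => norm_nonneg _) (fun n => hsup n x) hε0
  have Vplim : ∀ (q : ℝ) x, Tendsto (fun n => V n x ^ q) atTop (𝓝 (v x ^ q)) := fun q x =>
    (Vlim x).rpow_const (Or.inl (vpos x).ne')
  have I1 : Tendsto (fun n => ∫ x in (-π)..π, V n x) atTop (𝓝 (∫ x in (-π)..π, v x)) := by
    refine intervalIntegral.tendsto_integral_filter_of_dominated_convergence (fun _ => M + m / 2)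
      (Eventually.of_forall fun n => (Vc n).aestronglyMeasurable)
      (Eventually.of_forall fun n => ae_of_all _ fun x _ => ?_) intervalIntegrable_const
      (ae_of_all _ fun x _ => Vlim x)
    rw [norm_eq_abs, abs_of_pos (Vpos n x)]; exact Vhi n x
  have I2 : Tendsto (fun n => ∫ x in (-π)..π, (V n x ^ (1 / p)) ^ 2) atTop (𝓝 e) := by
    have : e = ∫ x in (-π)..π, (v x ^ (1 / p)) ^ 2 := by
      rw [he]; congr 1; funext x
      rw [hv]; simp only
      rw [← rpow_mul (hpos x).le, mul_one_div_cancel hp0.ne', rpow_one]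
    rw [this]
    refine intervalIntegral.tendsto_integral_filter_of_dominated_convergence
      (fun _ => ((M + m / 2) ^ (1 / p)) ^ 2)
      (Eventually.of_forall fun n => ?_)
      (Eventually.of_forall fun n => ae_of_all _ fun x _ => ?_) intervalIntegrable_const
      (ae_of_all _ fun x _ => (Vplim _ x).pow 2)
    · exact (((Vc n).rpow_const fun s => Or.inl (Vpos n s).ne').pow 2).aestronglyMeasurable
    · rw [norm_eq_abs, abs_of_nonneg (by positivity)]
      have := (Vpos n x).le
      have := Vhi n x
      gcongr
  have vI : 0 < ∫ x in (-π)..π, v x :=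
    intervalIntegral.intervalIntegral_pos_of_pos (vc.intervalIntegrable _ _) vpos (by linarith)
  have Epos : 0 < E := by rw [hE]; positivity
  have I3 : Tendsto (fun n => 2 * π * ((1 / (2 * π) * ∫ x in (-π)..π, V n x) ^ (1 / p)) ^ 2) atTop (𝓝 E) := by
    rw [hE]
    exact (((I1.const_mul _).rpow_const (Or.inl (by positivity))).pow 2).const_mul _
  have T := fun n => trig_ineq hp (S n) (A n) (B n) (m / 2) (by positivity) (Vlo n) (v := V n) (v1 := V1 n)
    rfl rfl rfl rfl rfl
  refine ⟨Epos, le_of_tendsto_of_tendsto' I2 I3 fun n => (T n).1, ?_⟩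
  have LL := ((I3.sub I2).div_const (p - 2)).add
    (((tendsto_const_nhds (x := (p - 1) / (6 * (p - 2) ^ 2))).div I3 Epos.ne').mul ((I3.sub I2).pow 2))
  set W := (1 / p * (m / 2) ^ (1 / p - 1)) ^ 2 with hW
  have q0 : 1 / p - 1 ≤ 0 := by
    have : 1 / p ≤ 1 := by rw [div_le_one hp0]; linarith
    linarith
  have wn : ∀ n x, (1 / p * V n x ^ (1 / p - 1)) ^ 2 ≤ W := fun n x => by
    have h1 : V n x ^ (1 / p - 1) ≤ (m / 2) ^ (1 / p - 1) :=
      rpow_le_rpow_of_nonpos (by positivity) (Vlo n x) q0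
    have h2 := (rpow_pos_of_pos (Vpos n x) (1 / p - 1)).le
    rw [hW]; gcongr
  have wc : ∀ n, Continuous fun x => (1 / p * V n x ^ (1 / p - 1)) ^ 2 := fun n =>
    (continuous_const.mul ((Vc n).rpow_const fun s => Or.inl (Vpos n s).ne')).pow 2
  have J : Tendsto (fun n => ∫ x in (-π)..π, (1 / p * V n x ^ (1 / p - 1)) ^ 2 * (deriv v x) ^ 2) atTop (𝓝 i) := by
    have : i = ∫ x in (-π)..π, (1 / p * v x ^ (1 / p - 1)) ^ 2 * (deriv v x) ^ 2 := by
      rw [hi]; congr 1; funext x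
      rw [vder, hv]; simp only
      rw [← rpow_mul (hpos x).le]
      have h1 : u x ^ (p * (1 / p - 1)) * u x ^ (p - 1) = 1 := by
        rw [← rpow_add (hpos x), show p * (1 / p - 1) + (p - 1) = 0 by field_simp; ring, rpow_zero]
      have h2 : 1 / p * u x ^ (p * (1 / p - 1)) * (deriv u x * p * u x ^ (p - 1)) = deriv u x := by
        calc _ = (1 / p * p) * (u x ^ (p * (1 / p - 1)) * u x ^ (p - 1)) * deriv u x := by ring
          _ = _ := by rw [h1, one_div_mul_cancel hp0.ne']; ring
      rw [← mul_pow, h2]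
    rw [this]
    refine intervalIntegral.tendsto_integral_filter_of_dominated_convergence
      (fun x => W * (deriv v x) ^ 2)
      (Eventually.of_forall fun n => ?_)
      (Eventually.of_forall fun n => ae_of_all _ fun x _ => ?_) (vL2.const_mul _)
      (ae_of_all _ fun x _ => (((Vplim _ x).const_mul _).pow 2).mul_const _)
    · exact ((wc n).measurable.mul ((measurable_deriv v).pow_const 2)).aestronglyMeasurable
    · rw [norm_eq_abs, abs_of_nonneg (by positivity)]
      exact mul_le_mul_of_nonneg_right (wn n x) (sq_nonneg _)
  have bound : ∀ η : ℝ, 0 < η → ∀ n, ∫ x in (-π)..π, (1 / p * V n x ^ (1 / p - 1) * V1 n x) ^ 2 ≤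
      (1 + η) * (∫ x in (-π)..π, (1 / p * V n x ^ (1 / p - 1)) ^ 2 * (deriv v x) ^ 2)
        + (1 + 1 / η) * W * (m / 2 * (1 / ((n : ℝ) + 1))) := by
    intro η hη n
    have dI : IntervalIntegrable (fun x => (V1 n x - deriv v x) ^ 2) volume (-π) π :=
      sub_sq_int (measurable_deriv v) (V1c n).measurable vL2
        (Continuous.intervalIntegrable ((V1c n).pow 2) _ _)
    have aI : IntervalIntegrable (fun x => (1 / p * V n x ^ (1 / p - 1)) ^ 2 * (deriv v x) ^ 2) volume (-π) π :=
      vL2.continuousOn_mul (wc n).continuousOn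
    have cI : IntervalIntegrable (fun x => (1 / p * V n x ^ (1 / p - 1) * V1 n x) ^ 2) volume (-π) π := by
      refine Continuous.intervalIntegrable ?_ _ _
      exact ((continuous_const.mul ((Vc n).rpow_const fun s => Or.inl (Vpos n s).ne')).mul (V1c n)).pow 2
    have h1 : ∫ x in (-π)..π, (1 / p * V n x ^ (1 / p - 1) * V1 n x) ^ 2 ≤
        ∫ x in (-π)..π, ((1 + η) * ((1 / p * V n x ^ (1 / p - 1)) ^ 2 * (deriv v x) ^ 2)
          + (1 + 1 / η) * W * (V1 n x - deriv v x) ^ 2) := by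
      refine intervalIntegral.integral_mono_on hpi2 cI ((aI.const_mul _).add (dI.const_mul _)) fun x _ => ?_
      have w0 := wn n x
      generalize 1 / p * V n x ^ (1 / p - 1) = w at w0
      generalize V1 n x = y
      generalize deriv v x = z
      have k1 : y ^ 2 ≤ (1 + η) * z ^ 2 + (1 + 1 / η) * (y - z) ^ 2 := by
        have : (1 + η) * z ^ 2 + (1 + 1 / η) * (y - z) ^ 2 - y ^ 2 = η * (z - (y - z) / η) ^ 2 := by
          field_simp; ring
        have h2 : 0 ≤ η * (z - (y - z) / η) ^ 2 := by positivity
        linarith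
      have k2 : w ^ 2 * ((1 + 1 / η) * (y - z) ^ 2) ≤ W * ((1 + 1 / η) * (y - z) ^ 2) := by
        gcongr
      have k3 := mul_le_mul_of_nonneg_left k1 (sq_nonneg w)
      nlinarith
    rw [intervalIntegral.integral_add (aI.const_mul _) (dI.const_mul _),
      intervalIntegral.integral_const_mul, intervalIntegral.integral_const_mul] at h1
    refine h1.trans ?_
    have := hint n
    have W0 : 0 ≤ W := sq_nonneg _
    gcongr
  have fin : ∀ η : ℝ, 0 < η → (E - e) / (p - 2) + (p - 1) / (6 * (p - 2) ^ 2) / E * (E - e) ^ 2 ≤ (1 + η) * i := by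
    intro η hη
    have R := (J.const_mul (1 + η)).add (hε0.const_mul ((1 + 1 / η) * W))
    rw [mul_zero, add_zero] at R
    exact le_of_tendsto_of_tendsto' LL R fun n => (T n).2.trans (bound η hη n)
  have i0 : 0 ≤ i := by
    rw [hi]; exact intervalIntegral.integral_nonneg hpi2 fun x _ => sq_nonneg _
  by_contra hcon
  push Not at hcon
  have h1 := fin (((E - e) / (p - 2) + (p - 1) / (6 * (p - 2) ^ 2) / E * (E - e) ^ 2 - i) / (2 * (i + 1)))
    (div_pos (by linarith) (by positivity))
  generalize (E - e) / (p - 2) + (p - 1) / (6 * (p - 2) ^ 2) / E * (E - e) ^ 2 = L at h1 hcon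
  have h2 : (L - i) / (2 * (i + 1)) * i ≤ (L - i) / 2 := by
    rw [div_mul_eq_mul_div, div_le_div_iff₀ (by positivity) (by positivity)]
    nlinarith
  linarith

end Helpers

/-- rigidity region: if `p > 2`, `a ∈ [0,1/2]`, `α > -a²` and
`a²(p+2) + α(p-2) ≤ 1`, then for every positive `u ∈ H¹(S¹)`,
`‖u'‖² + a² (‖u⁻¹‖²)⁻¹ + α ‖u‖² ≥ (a²+α) ‖u‖²_{L^p}`, with equality only
for constants. Norms with respect to `dσ = ds/(2π)`. -/
theorem rigidity_region (p a α : ℝ) (hp : 2 < p) (ha0 : 0 ≤ a) (ha1 : a ≤ 1 / 2)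
    (hα : -a ^ 2 < α) (hcond : a ^ 2 * (p + 2) + α * (p - 2) ≤ 1)
    (u : ℝ → ℝ) (hu : Continuous u) (hper : Function.Periodic u (2 * π))
    (hpos : ∀ s, 0 < u s) (hdiff : Differentiable ℝ u)
    (hL2 : IntervalIntegrable (fun s => (deriv u s) ^ 2) volume (-π) π) :
    (a ^ 2 + α) * ((1 / (2 * π)) * ∫ s in (-π)..π, (u s) ^ p) ^ (2 / p)
      ≤ (1 / (2 * π)) * (∫ s in (-π)..π, (deriv u s) ^ 2)
        + a ^ 2 * ((1 / (2 * π)) * ∫ s in (-π)..π, (u s)⁻¹ ^ 2)⁻¹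
        + α * ((1 / (2 * π)) * ∫ s in (-π)..π, (u s) ^ 2)
    ∧ (((a ^ 2 + α) * ((1 / (2 * π)) * ∫ s in (-π)..π, (u s) ^ p) ^ (2 / p)
        = (1 / (2 * π)) * (∫ s in (-π)..π, (deriv u s) ^ 2)
          + a ^ 2 * ((1 / (2 * π)) * ∫ s in (-π)..π, (u s)⁻¹ ^ 2)⁻¹
          + α * ((1 / (2 * π)) * ∫ s in (-π)..π, (u s) ^ 2))
      → ∃ c : ℝ, ∀ s : ℝ, u s = c) := by
  have hpi := pi_pos
  have hp0 : 0 < p := by linarith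
  obtain ⟨E0, h1, h2⟩ := improved hp hper hpos hdiff hL2 rfl rfl rfl
  have ehl := EHL hper hpos hdiff hL2
  have I0 : 0 < 1 / (2 * π) * ∫ s in (-π)..π, (u s) ^ p := by
    have : 0 < ∫ s in (-π)..π, (u s) ^ p :=
      intervalIntegral.intervalIntegral_pos_of_pos
        ((hu.rpow_const fun s => Or.inl (hpos s).ne').intervalIntegrable _ _)
        (fun s => rpow_pos_of_pos (hpos s) p) (by linarith)
    positivity
  have hE : (1 / (2 * π) * ∫ s in (-π)..π, (u s) ^ p) ^ (2 / p)
      = 1 / (2 * π) * (2 * π * ((1 / (2 * π) * ∫ x in (-π)..π, u x ^ p) ^ (1 / p)) ^ 2) := by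
    rw [← rpow_natCast, ← rpow_mul I0.le, show 1 / p * ((2 : ℕ) : ℝ) = 2 / p by push_cast; ring]
    field_simp
  rw [hE]
  have i0 : 0 ≤ ∫ s in (-π)..π, (deriv u s) ^ 2 :=
    intervalIntegral.integral_nonneg (by linarith) fun x _ => sq_nonneg _
  have hK : (1 / (2 * π) * ∫ s in (-π)..π, (u s)⁻¹ ^ 2)⁻¹
      = 1 / (2 * π) * (4 * π ^ 2 * (∫ s in (-π)..π, (u s)⁻¹ ^ 2)⁻¹) := by
    rw [mul_inv]; field_simp; ring
  rw [hK]
  have fI := sq_int_to_int (measurable_deriv u) hL2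
  have hconst : (∫ s in (-π)..π, (deriv u s) ^ 2) = 0 → ∃ c : ℝ, ∀ s : ℝ, u s = c := by
    intro h
    have ae0 := (intervalIntegral.integral_eq_zero_iff_of_le_of_nonneg_ae (by linarith)
      (ae_of_all _ fun x => sq_nonneg _) hL2).1 h
    have main : ∀ x ∈ Set.Ioc (-π) π, u x = u (-π) := by
      intro x hx
      have hsub : Set.uIcc (-π) x ⊆ Set.uIcc (-π) π := by
        rw [Set.uIcc_of_le hx.1.le, Set.uIcc_of_le (by linarith)]
        exact Set.Icc_subset_Icc le_rfl hx.2
      have F := intervalIntegral.integral_deriv_eq_sub (a := -π) (b := x) (f := u)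
        (fun y _ => hdiff y) (fI.mono_set hsub)
      have z : ∫ y in (-π)..x, deriv u y = 0 := by
        rw [intervalIntegral.integral_of_le hx.1.le]
        refine integral_eq_zero_of_ae ?_
        have := ae_restrict_of_ae_restrict_of_subset (Set.Ioc_subset_Ioc le_rfl hx.2) ae0
        filter_upwards [this] with y hy
        exact pow_eq_zero_iff (two_ne_zero) |>.1 hy
      linarith
    refine ⟨u (-π), fun s => ?_⟩
    obtain ⟨z, hz, e⟩ := hper.exists_mem_Ioc (by positivity) s (-π)
    rw [show -π + 2 * π = π by ring] at hz
    rw [e, main z hz]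
  generalize (2 * π * ((1 / (2 * π) * ∫ x in (-π)..π, u x ^ p) ^ (1 / p)) ^ 2) = E at *
  generalize (∫ s in (-π)..π, (deriv u s) ^ 2) = i at *
  generalize (4 * π ^ 2 * (∫ s in (-π)..π, (u s)⁻¹ ^ 2)⁻¹) = k at *
  generalize (∫ s in (-π)..π, (u s) ^ 2) = e at *
  have hq : 0 < p - 2 := by linarith
  have hb : 0 < a ^ 2 + α := by linarith
  have hc : (a ^ 2 + α) * (p - 2) ≤ 1 - 4 * a ^ 2 := by nlinarith
  have ha : 0 < 1 - 4 * a ^ 2 := lt_of_lt_of_le (mul_pos hb hq) hc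
  set R := (p - 1) / (6 * (p - 2) ^ 2) / E * (E - e) ^ 2 with hR
  have hκ : 0 < (p - 1) / (6 * (p - 2) ^ 2) / E :=
    div_pos (div_pos (by linarith) (by positivity)) E0
  have R0 : 0 ≤ R := by rw [hR]; positivity
  have k1 : (a ^ 2 + α) * (E - e) ≤ (1 - 4 * a ^ 2) * ((E - e) / (p - 2)) := by
    rw [mul_div_assoc', le_div_iff₀ hq]
    nlinarith [mul_le_mul_of_nonneg_right hc (sub_nonneg.2 h1)]
  have k2 := mul_le_mul_of_nonneg_left h2 ha.le
  have k3 := mul_le_mul_of_nonneg_left ehl (sq_nonneg a)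
  have k4 : (1 - 4 * a ^ 2) * R + (a ^ 2 + α) * E ≤ i + a ^ 2 * k + α * e := by nlinarith
  have ht : 0 < 1 / (2 * π) := by positivity
  constructor
  · have := mul_le_mul_of_nonneg_left k4 ht.le
    nlinarith [mul_nonneg ht.le (mul_nonneg ha.le R0)]
  · intro heq
    have heq2 : (a ^ 2 + α) * E = i + a ^ 2 * k + α * e := by
      have : 1 / (2 * π) * ((a ^ 2 + α) * E) = 1 / (2 * π) * (i + a ^ 2 * k + α * e) := by linarith
      exact mul_left_cancel₀ ht.ne' this
    have hR0 : R = 0 := by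
      have : (1 - 4 * a ^ 2) * R ≤ 0 := by linarith
      nlinarith [mul_nonneg ha.le R0]
    have hEe : E - e = 0 := by
      rw [hR] at hR0
      rcases mul_eq_zero.1 hR0 with h | h
      · exact absurd h hκ.ne'
      · exact pow_eq_zero_iff (two_ne_zero) |>.1 h
    apply hconst
    have hEe' : E = e := by linarith
    subst hEe'
    have h5 : (1 - 4 * a ^ 2) * i ≤ 0 := by linarith
    have h6 : i ≤ 0 := by
      by_contra hcon
      push Not at hcon
      exact absurd (mul_pos ha hcon) (not_lt.2 h5)
    exact le_antisymm h6 i0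
end
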